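/- arXiv:2211.14850 — 6 statements merged into one kernel-verified Lean document; each statement's English description precedes it below -/
import Mathlib

section
/- Let F : ℝⁿ ⇉ ℝⁿ be an upper semicontinuous set-valued map with nonempty, compact, and convex values, let X₀ ⊆ ℝⁿ be compact, and let T > 0. Assume there exist ᾱ > 0 and r > 0 such that for every α ∈ (0, ᾱ] and every sequence (x_k)_{k∈ℕ} with x₀ ∈ X₀ and x_{k+1} ∈ x_k + α·F(x_k) for all k ∈ ℕ, the iterates x₀, …, x_{⌊T/α⌋+1} all lie in the closed ball B(0, r). Then for every ε > 0 there exists α̂ ∈ (0, ᾱ] such that for every α ∈ (0, α̂] and every such sequence (x_k)_{k∈ℕ}, there exists a solution x : [0, T] → ℝⁿ of the differential inclusion x′(t) ∈ F(x(t)) for a.e. t ∈ (0, T) with x(0) ∈ X₀, such that ‖x̄(t) − x(t)‖ ≤ ε for all t ∈ [0, T], where x̄ : [0, T] → ℝⁿ is the piecewise-linear interpolation of the iterates defined by x̄(t) := x_k + ((t − αk)/α)(x_{k+1} − x_k) for t ∈ [αk, min{α(k+1), T}] and k ∈ {0, …, ⌊T/α⌋}. -/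
open Metric Set MeasureTheory

/-- A set-valued map `F : ℝⁿ ⇉ ℝⁿ` is upper semicontinuous if for every `x` and every open
set `U ⊇ F x` there is `δ > 0` such that `F y ⊆ U` whenever `‖y - x‖ ≤ δ`. -/
def UpperSemicontinuousSetValued {n : ℕ}
    (F : EuclideanSpace ℝ (Fin n) → Set (EuclideanSpace ℝ (Fin n))) : Prop :=
  ∀ x : EuclideanSpace ℝ (Fin n), ∀ U : Set (EuclideanSpace ℝ (Fin n)),
    IsOpen U → F x ⊆ U → ∃ δ > (0 : ℝ), ∀ y, ‖y - x‖ ≤ δ → F y ⊆ U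

/-- The piecewise linear interpolation of the iterates `(x_k)` with step size `α`:
on each interval `[α k, α (k + 1)]` it is given by
`x̄ t = x_k + ((t - α k) / α) • (x_{k+1} - x_k)`. -/
noncomputable def piecewiseLinearInterp {n : ℕ} (α : ℝ) (x : ℕ → EuclideanSpace ℝ (Fin n))
    (t : ℝ) : EuclideanSpace ℝ (Fin n) :=
  x ⌊t / α⌋₊ + ((t - α * ⌊t / α⌋₊) / α) • (x (⌊t / α⌋₊ + 1) - x ⌊t / α⌋₊)

open Filter Topology
open scoped NNReal

lemma aux_bound {n : ℕ} (F : EuclideanSpace ℝ (Fin n) → Set (EuclideanSpace ℝ (Fin n)))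
    (hF_usc : UpperSemicontinuousSetValued F) (hF_cpt : ∀ x, IsCompact (F x)) (r : ℝ) :
    ∃ M : ℝ≥0, ∀ x ∈ closedBall (0 : EuclideanSpace ℝ (Fin n)) r, ∀ s ∈ F x, ‖s‖ ≤ M := by
  refine (isCompact_closedBall (0 : EuclideanSpace ℝ (Fin n)) r).induction_on
    (p := fun S => ∃ M : ℝ≥0, ∀ x ∈ S, ∀ s ∈ F x, ‖s‖ ≤ M) ?_ ?_ ?_ ?_
  · exact ⟨0, by simp⟩
  · rintro S S' h ⟨M, hM⟩
    exact ⟨M, fun x hx => hM x (h hx)⟩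
  · rintro S S' ⟨M, hM⟩ ⟨M', hM'⟩
    refine ⟨max M M', fun x hx s hs => ?_⟩
    rw [NNReal.coe_max]
    rcases hx with hx | hx
    · exact (hM x hx s hs).trans (le_max_left _ _)
    · exact (hM' x hx s hs).trans (le_max_right _ _)
  · intro x _
    obtain ⟨R, hR⟩ := (hF_cpt x).isBounded.subset_ball 0
    obtain ⟨δ, hδ, h⟩ := hF_usc x _ isOpen_ball hR
    refine ⟨closedBall x δ, mem_nhdsWithin_of_mem_nhds (closedBall_mem_nhds x hδ),
      ⟨R.toNNReal, fun y hy s hs => ?_⟩⟩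
    have := h y (by rwa [mem_closedBall, dist_eq_norm] at hy) hs
    rw [mem_ball_zero_iff] at this
    exact this.le.trans (Real.le_coe_toNNReal R)

lemma aux_ftc {n : ℕ} {C : ℝ≥0} {y : ℝ → EuclideanSpace ℝ (Fin n)} (hy : LipschitzWith C y)
    (a b : ℝ) : IntervalIntegrable (deriv y) volume a b ∧
      ∫ s in a..b, deriv y s = y b - y a := by
  have hint : IntervalIntegrable (deriv y) volume a b := by
    refine (intervalIntegrable_const (c := (C : ℝ))).mono_fun
      (measurable_deriv y).aestronglyMeasurable ?_
    refine Eventually.of_forall fun t => ?_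
    simpa using norm_deriv_le_of_lipschitz hy
  refine ⟨hint, ?_⟩
  ext i
  have h1 := (EuclideanSpace.proj i : EuclideanSpace ℝ (Fin n) →L[ℝ] ℝ).intervalIntegral_comp_comm hint
  refine h1.symm.trans ?_
  have hL : LipschitzWith C (fun t => y t i) := by
    refine LipschitzWith.of_dist_le_mul fun s t => ?_
    refine le_trans ?_ (hy.dist_le_mul s t)
    rw [dist_eq_norm, dist_eq_norm]
    exact PiLp.norm_apply_le (y s - y t) i
  have h2 := (hL.lipschitzOnWith (s := uIcc a b)).absolutelyContinuousOnInterval.integral_deriv_eq_sub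
  rw [PiLp.sub_apply, ← h2]
  refine intervalIntegral.integral_congr_ae ?_
  filter_upwards [hy.ae_differentiableAt_real] with t ht _
  exact (((EuclideanSpace.proj i : EuclideanSpace ℝ (Fin n) →L[ℝ] ℝ).hasFDerivAt.comp_hasDerivAt t
    ht.hasDerivAt).deriv).symm

lemma aux_step_int {n : ℕ} (α : ℝ) (hα : 0 < α) (s : ℕ → EuclideanSpace ℝ (Fin n)) (a b : ℝ) :
    IntervalIntegrable (fun u => s ⌊u / α⌋₊) volume a b := by
  have hmeas : Measurable (fun u : ℝ => s ⌊u / α⌋₊) :=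
    (measurable_from_top (f := s)).comp (Nat.measurable_floor.comp (measurable_id.div_const α))
  refine (intervalIntegrable_const
    (c := ∑ k ∈ Finset.range (⌊max a b / α⌋₊ + 1), ‖s k‖)).mono_fun
      hmeas.aestronglyMeasurable ?_
  rw [EventuallyLE, ae_restrict_iff' measurableSet_uIoc]
  refine Eventually.of_forall fun u hu => ?_
  refine le_trans ?_ (le_abs_self _)
  refine Finset.single_le_sum (f := fun k => ‖s k‖) (fun _ _ => norm_nonneg _) ?_
  rw [Finset.mem_range, Nat.lt_succ_iff]
  exact Nat.floor_le_floor (div_le_div_of_nonneg_right hu.2 hα.le)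

lemma aux_piece {n : ℕ} (α : ℝ) (hα : 0 < α) (s : ℕ → EuclideanSpace ℝ (Fin n)) (k : ℕ) (t : ℝ)
    (h1 : α * k ≤ t) (h2 : t ≤ α * (k + 1)) :
    ∫ u in (α * k)..t, s ⌊u / α⌋₊ = (t - α * k) • s k := by
  rw [← intervalIntegral.integral_const]
  refine intervalIntegral.integral_congr_ae ?_
  have : ∀ᵐ u : ℝ, u ≠ t := by simp [ae_iff]
  filter_upwards [this] with u hu hu'
  rw [uIoc_of_le h1] at hu'
  congr 1
  rw [Nat.floor_eq_iff (div_nonneg ((by positivity : 0 ≤ α * k).trans hu'.1.le) hα.le),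
    le_div_iff₀ hα, div_lt_iff₀ hα]
  have := lt_of_le_of_ne hu'.2 hu
  constructor <;> nlinarith [hu'.1]

lemma aux_interp {n : ℕ} (α : ℝ) (hα : 0 < α) (x s : ℕ → EuclideanSpace ℝ (Fin n))
    (hx : ∀ k, x (k + 1) = x k + α • s k) (t : ℝ) (ht : 0 ≤ t) :
    piecewiseLinearInterp α x t = x 0 + ∫ u in (0 : ℝ)..t, s ⌊u / α⌋₊ := by
  have hnode : ∀ k : ℕ, x k = x 0 + ∫ u in (0 : ℝ)..(α * k), s ⌊u / α⌋₊ := by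
    intro k
    induction k with
    | zero => simp
    | succ k ih =>
      have := aux_piece α hα s k (α * (k + 1)) (by nlinarith) le_rfl
      rw [hx, ih, add_assoc]
      congr 1
      rw [← intervalIntegral.integral_add_adjacent_intervals (b := α * k)
        (c := α * ((k + 1 : ℕ) : ℝ)) (aux_step_int α hα s _ _) (aux_step_int α hα s _ _)]
      push_cast
      rw [this]
      congr 2
      ring
  have hk1 : α * (⌊t / α⌋₊ : ℝ) ≤ t := by
    have := Nat.floor_le (div_nonneg ht hα.le)
    rwa [le_div_iff₀ hα, mul_comm] at this
  have hk2 : t ≤ α * ((⌊t / α⌋₊ : ℝ) + 1) := by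
    have := (Nat.lt_floor_add_one (t / α)).le
    rwa [div_le_iff₀ hα, mul_comm] at this
  unfold piecewiseLinearInterp
  rw [← intervalIntegral.integral_add_adjacent_intervals (b := α * ⌊t / α⌋₊)
        (aux_step_int α hα s _ _) (aux_step_int α hα s _ _), aux_piece α hα s _ t hk1 hk2,
    ← add_assoc, ← hnode, hx, add_sub_cancel_left, smul_smul, div_mul_cancel₀ _ hα.ne']

lemma aux_near {n : ℕ} (α : ℝ) (hα : 0 < α) (x s : ℕ → EuclideanSpace ℝ (Fin n))
    (hx : ∀ k, x (k + 1) = x k + α • s k) (t M : ℝ) (ht : 0 ≤ t) (hs : ‖s ⌊t / α⌋₊‖ ≤ M) :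
    ‖x ⌊t / α⌋₊ - piecewiseLinearInterp α x t‖ ≤ α * M := by
  have hk1 : α * (⌊t / α⌋₊ : ℝ) ≤ t := by
    have := Nat.floor_le (div_nonneg ht hα.le)
    rwa [le_div_iff₀ hα, mul_comm] at this
  have hk2 : t ≤ α * ((⌊t / α⌋₊ : ℝ) + 1) := by
    have := (Nat.lt_floor_add_one (t / α)).le
    rwa [div_le_iff₀ hα, mul_comm] at this
  unfold piecewiseLinearInterp
  rw [hx, add_sub_cancel_left, smul_smul, div_mul_cancel₀ _ hα.ne', sub_add_cancel_left, norm_neg,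
    norm_smul, Real.norm_of_nonneg (by linarith)]
  exact mul_le_mul (by linarith) hs (norm_nonneg _) hα.le

lemma aux_mean {n : ℕ} (α : ℝ) (hα : 0 < α) (x s : ℕ → EuclideanSpace ℝ (Fin n))
    (hx : ∀ k, x (k + 1) = x k + α • s k) (a h : ℝ) (ha : 0 ≤ a) (hh : 0 < h)
    (C : Set (EuclideanSpace ℝ (Fin n))) (hC : Convex ℝ C) (hC' : IsClosed C)
    (hs : ∀ u ∈ Icc a (a + h), s ⌊u / α⌋₊ ∈ C) :
    h⁻¹ • (piecewiseLinearInterp α x (a + h) - piecewiseLinearInterp α x a) ∈ C := by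
  rw [aux_interp α hα x s hx a ha, aux_interp α hα x s hx (a + h) (by linarith),
    add_sub_add_left_eq_sub, intervalIntegral.integral_interval_sub_left
    (aux_step_int α hα s _ _) (aux_step_int α hα s _ _)]
  have := hC.set_average_mem (μ := volume) (t := Ioc a (a + h)) (f := fun u => s ⌊u / α⌋₊) hC'
    (by simp [hh]) (by simp)
    (by
      rw [ae_restrict_iff' measurableSet_Ioc]
      exact Eventually.of_forall fun u hu => hs u ⟨hu.1.le, hu.2⟩)
    ((intervalIntegrable_iff_integrableOn_Ioc_of_le (by linarith)).1 (aux_step_int α hα s _ _))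
  rw [setAverage_eq] at this
  rw [intervalIntegral.integral_of_le (by linarith)]
  simpa [Measure.real, hh.le] using this

lemma aux_lip {n : ℕ} (α : ℝ) (hα : 0 < α) (x s : ℕ → EuclideanSpace ℝ (Fin n))
    (hx : ∀ k, x (k + 1) = x k + α • s k) (T : ℝ) (M : ℝ≥0)
    (hs : ∀ k ≤ ⌊T / α⌋₊, ‖s k‖ ≤ M) :
    LipschitzOnWith M (piecewiseLinearInterp α x) (Icc 0 T) := by
  refine LipschitzOnWith.of_dist_le_mul fun a ha b hb => ?_
  rw [dist_eq_norm, aux_interp α hα x s hx a ha.1, aux_interp α hα x s hx b hb.1,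
    add_sub_add_left_eq_sub, intervalIntegral.integral_interval_sub_left
    (aux_step_int α hα s _ _) (aux_step_int α hα s _ _), Real.dist_eq]
  refine intervalIntegral.norm_integral_le_of_norm_le_const fun u hu => hs _ ?_
  refine Nat.floor_le_floor (div_le_div_of_nonneg_right (hu.2.trans (max_le hb.2 ha.2)) hα.le)

lemma aux_deriv {n : ℕ} (F : EuclideanSpace ℝ (Fin n) → Set (EuclideanSpace ℝ (Fin n)))
    (hF_usc : UpperSemicontinuousSetValued F) (hF_cpt : ∀ x, IsCompact (F x))
    (hF_cvx : ∀ x, Convex ℝ (F x)) (T : ℝ) (M : ℝ≥0)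
    (α : ℕ → ℝ) (hα : ∀ m, 0 < α m) (hα0 : Tendsto α atTop (𝓝 0))
    (x s : ℕ → ℕ → EuclideanSpace ℝ (Fin n))
    (hx : ∀ m k, x m (k + 1) = x m k + α m • s m k)
    (hsF : ∀ m k, s m k ∈ F (x m k))
    (hs : ∀ m, ∀ k ≤ ⌊T / α m⌋₊, ‖s m k‖ ≤ M)
    (y : ℝ → EuclideanSpace ℝ (Fin n))
    (hy : TendstoUniformlyOn (fun m => piecewiseLinearInterp (α m) (x m)) y atTop (Icc 0 T))
    (t : ℝ) (ht : t ∈ Ioo 0 T) (v : EuclideanSpace ℝ (Fin n)) (hv : HasDerivAt y v t) :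
    v ∈ F (y t) := by
  rw [← (hF_cpt (y t)).isClosed.closure_eq, closure_eq_iInter_cthickening]
  simp only [mem_iInter]
  intro δ hδ
  obtain ⟨η, hη, hU⟩ := hF_usc (y t) _ isOpen_thickening (self_subset_thickening hδ (F (y t)))
  have hη3 : 0 < η / 3 := by positivity
  refine isClosed_cthickening.mem_of_tendsto hv.tendsto_slope_zero_right ?_
  obtain ⟨ρ, hρ, hcont⟩ := Metric.continuousAt_iff.1 hv.continuousAt (η / 3) hη3
  have hpos : 0 < min (T - t) ρ := lt_min (by linarith [ht.2]) hρ
  filter_upwards [Ioo_mem_nhdsGT hpos] with h hh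
  have hhT := hh.2.trans_le (min_le_left _ _)
  have hhρ := hh.2.trans_le (min_le_right _ _)
  have hh0 := hh.1
  have ht0 := ht.1
  have hlim : Tendsto (fun m => h⁻¹ • (piecewiseLinearInterp (α m) (x m) (t + h) -
      piecewiseLinearInterp (α m) (x m) t)) atTop (𝓝 (h⁻¹ • (y (t + h) - y t))) :=
    ((hy.tendsto_at ⟨by linarith, by linarith⟩).sub
      (hy.tendsto_at ⟨ht.1.le, ht.2.le⟩)).const_smul _
  refine isClosed_cthickening.mem_of_tendsto hlim ?_
  have hαM : Tendsto (fun m => α m * (M : ℝ)) atTop (𝓝 0) := by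
    simpa using hα0.mul_const (M : ℝ)
  filter_upwards [Metric.tendstoUniformlyOn_iff.1 hy (η / 3) hη3,
    hαM.eventually (gt_mem_nhds hη3)] with m hm1 hm2
  refine aux_mean (α m) (hα m) (x m) (s m) (hx m) t h ht.1.le hh0 _ ((hF_cvx _).cthickening δ)
    isClosed_cthickening fun u hu => ?_
  refine thickening_subset_cthickening _ _ (hU (x m ⌊u / α m⌋₊) ?_ (hsF m _))
  have hu0 : 0 ≤ u := ht0.le.trans hu.1
  have huT : u ≤ T := by linarith [hu.2]
  have e1 := aux_near (α m) (hα m) (x m) (s m) (hx m) u M hu0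
    (hs m _ (Nat.floor_le_floor (div_le_div_of_nonneg_right huT (hα m).le)))
  have e2 := hm1 u ⟨hu0, huT⟩
  have e3 := @hcont u (by rw [Real.dist_eq, abs_of_nonneg (by linarith [hu.1])]; linarith [hu.2])
  rw [dist_comm, dist_eq_norm] at e2
  rw [dist_eq_norm] at e3
  have e4 := norm_sub_le_norm_sub_add_norm_sub (x m ⌊u / α m⌋₊)
    (piecewiseLinearInterp (α m) (x m) u) (y t)
  have e5 := norm_sub_le_norm_sub_add_norm_sub (piecewiseLinearInterp (α m) (x m) u) (y u) (y t)
  linarith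

lemma aux_compact {n : ℕ} (T R : ℝ) (hT : 0 ≤ T) (M : ℝ≥0)
    (f : ℕ → ℝ → EuclideanSpace ℝ (Fin n))
    (hf : ∀ m, LipschitzOnWith M (f m) (Icc 0 T)) (hR : ∀ m, ∀ t ∈ Icc 0 T, ‖f m t‖ ≤ R) :
    ∃ (y : ℝ → EuclideanSpace ℝ (Fin n)) (φ : ℕ → ℕ), StrictMono φ ∧ LipschitzWith M y ∧
      TendstoUniformlyOn (fun m => f (φ m)) y atTop (Icc 0 T) := by
  let A : Set (BoundedContinuousFunction (Icc (0 : ℝ) T) (EuclideanSpace ℝ (Fin n))) :=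
    {g | (∀ t, g t ∈ closedBall (0 : EuclideanSpace ℝ (Fin n)) R) ∧
      ∀ a b, dist (g a) (g b) ≤ M * dist a b}
  have hA : IsCompact A := by
    refine BoundedContinuousFunction.arzela_ascoli₂ _ (isCompact_closedBall 0 R) A ?_
      (fun g t hg => hg.1 t) ?_
    · have hc : ∀ t : Icc (0 : ℝ) T, Continuous
          (fun g : BoundedContinuousFunction (Icc (0 : ℝ) T) (EuclideanSpace ℝ (Fin n)) => g t) :=
        fun t => continuous_eval_const t
      have : A = (⋂ t, {g | g t ∈ closedBall (0 : EuclideanSpace ℝ (Fin n)) R}) ∩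
          ⋂ a, ⋂ b, {g | dist (g a) (g b) ≤ M * dist a b} := by
        ext g; simp only [A, mem_inter_iff, mem_iInter, mem_ofPred_eq]
      rw [this]
      refine (isClosed_iInter fun t => isClosed_closedBall.preimage (hc t)).inter
        (isClosed_iInter fun a => isClosed_iInter fun b => ?_)
      exact isClosed_le ((hc a).dist (hc b)) continuous_const
    · refine Metric.equicontinuous_of_continuity_modulus (fun d => M * d) ?_ _ ?_
      · have hc : Continuous fun d : ℝ => (M : ℝ) * d := by fun_prop
        simpa only [mul_zero] using hc.tendsto 0
      · intro a b g
        exact g.2.2 a b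
  let G : ℕ → BoundedContinuousFunction (Icc (0 : ℝ) T) (EuclideanSpace ℝ (Fin n)) := fun m =>
    BoundedContinuousFunction.mkOfCompact ⟨(Icc 0 T).domRestrict (f m), (hf m).continuousOn.domRestrict⟩
  have hG : ∀ m, G m ∈ A := fun m =>
    ⟨fun t => mem_closedBall_zero_iff.2 (hR m t t.2), fun a b => (hf m).dist_le_mul a a.2 b b.2⟩
  obtain ⟨g, hg, φ, hφ, hlim⟩ := hA.tendsto_subseq hG
  refine ⟨fun t => g (projIcc 0 T hT t), φ, hφ, ?_, ?_⟩
  · have : LipschitzWith M g := LipschitzWith.of_dist_le_mul hg.2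
    have h2 := this.comp (LipschitzWith.projIcc hT)
    rw [mul_one] at h2
    exact h2
  · rw [Metric.tendstoUniformlyOn_iff]
    intro ε hε
    filter_upwards [Metric.tendsto_nhds.1 hlim ε hε] with m hm t ht
    have h1 := (BoundedContinuousFunction.dist_coe_le_dist (f := G (φ m)) (g := g) ⟨t, ht⟩).trans_lt hm
    simp only [projIcc_of_mem hT ht]
    rw [dist_comm]
    exact h1

/-- If all Euler iterates with step sizes `α ∈ (0, ᾱ]` starting in the compact set `X₀` remain
in the ball `B(0, r)` up to iteration `⌊T/α⌋ + 1`, then for every `ε > 0` there is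
`αh ∈ (0, ᾱ]` such that for every `α ∈ (0, αh]`, every Euler sequence with step size `α` is
`ε`-shadowed on `[0, T]` (via its piecewise linear interpolation) by a solution of the
differential inclusion `x' ∈ F(x)`, `x(0) ∈ X₀`. -/
theorem euler_approximates_solution {n : ℕ}
    (F : EuclideanSpace ℝ (Fin n) → Set (EuclideanSpace ℝ (Fin n)))
    (hF_usc : UpperSemicontinuousSetValued F)
    (hF_ne : ∀ x, (F x).Nonempty)
    (hF_cpt : ∀ x, IsCompact (F x))
    (hF_cvx : ∀ x, Convex ℝ (F x))
    (X₀ : Set (EuclideanSpace ℝ (Fin n))) (hX₀ : IsCompact X₀)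
    (T : ℝ) (hT : 0 < T)
    (ᾱ r : ℝ) (hᾱ : 0 < ᾱ) (hr : 0 < r)
    (hbdd : ∀ α ∈ Set.Ioc (0 : ℝ) ᾱ, ∀ x : ℕ → EuclideanSpace ℝ (Fin n),
      x 0 ∈ X₀ → (∀ k : ℕ, ∃ s ∈ F (x k), x (k + 1) = x k + α • s) →
      ∀ k ≤ ⌊T / α⌋₊ + 1, x k ∈ closedBall (0 : EuclideanSpace ℝ (Fin n)) r) :
    ∀ ε > (0 : ℝ), ∃ αh ∈ Set.Ioc (0 : ℝ) ᾱ, ∀ α ∈ Set.Ioc (0 : ℝ) αh,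
      ∀ x : ℕ → EuclideanSpace ℝ (Fin n),
        x 0 ∈ X₀ → (∀ k : ℕ, ∃ s ∈ F (x k), x (k + 1) = x k + α • s) →
        ∃ y v : ℝ → EuclideanSpace ℝ (Fin n),
          IntegrableOn v (Set.Icc 0 T) ∧
          (∀ t ∈ Set.Icc (0 : ℝ) T, y t = y 0 + ∫ s in (0 : ℝ)..t, v s) ∧
          (∀ᵐ t ∂(volume.restrict (Set.Ioo (0 : ℝ) T)), v t ∈ F (y t)) ∧
          y 0 ∈ X₀ ∧
          (∀ t ∈ Set.Icc (0 : ℝ) T, ‖piecewiseLinearInterp α x t - y t‖ ≤ ε) := by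
  intro ε hε
  by_contra hcon
  push Not at hcon
  obtain ⟨M, hM⟩ := aux_bound F hF_usc hF_cpt r
  have hstep : ∀ m : ℕ, min ᾱ (1 / ((m : ℝ) + 1)) ∈ Set.Ioc (0 : ℝ) ᾱ := fun m =>
    ⟨lt_min hᾱ (by positivity), min_le_left _ _⟩
  choose α hα x hx0 hx hno using fun m => hcon _ (hstep m)
  choose s hsF hxs using hx
  have hαpos : ∀ m, 0 < α m := fun m => (hα m).1
  have hα0 : Tendsto α atTop (𝓝 0) :=
    squeeze_zero (fun m => (hαpos m).le) (fun m => (hα m).2.trans (min_le_right _ _))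
      tendsto_one_div_add_atTop_nhds_zero_nat
  have hball : ∀ m, ∀ k ≤ ⌊T / α m⌋₊ + 1, x m k ∈ closedBall (0 : EuclideanSpace ℝ (Fin n)) r :=
    fun m => hbdd (α m) ⟨hαpos m, (hα m).2.trans (min_le_left _ _)⟩ (x m) (hx0 m)
      fun k => ⟨s m k, hsF m k, hxs m k⟩
  have hs : ∀ m, ∀ k ≤ ⌊T / α m⌋₊, ‖s m k‖ ≤ M := fun m k hk =>
    hM _ (hball m k (hk.trans (Nat.le_succ _))) _ (hsF m k)
  have hlip := fun m => aux_lip (α m) (hαpos m) (x m) (s m) (hxs m) T M (hs m)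
  have hzero : ∀ m, piecewiseLinearInterp (α m) (x m) 0 = x m 0 := fun m => by
    rw [aux_interp (α m) (hαpos m) (x m) (s m) (hxs m) 0 le_rfl]; simp
  have h0mem : (0 : ℝ) ∈ Set.Icc 0 T := ⟨le_rfl, hT.le⟩
  obtain ⟨y, φ, hφ, hyL, hy⟩ := aux_compact T (r + M * T) hT.le M
    (fun m => piecewiseLinearInterp (α m) (x m)) hlip (by
      intro m t ht
      have h1 := (hlip m).dist_le_mul t ht 0 h0mem
      rw [hzero, dist_eq_norm, Real.dist_eq, sub_zero, abs_of_nonneg ht.1] at h1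
      have h2 := hball m 0 (Nat.zero_le _)
      rw [mem_closedBall_zero_iff] at h2
      have h3 : (M : ℝ) * t ≤ M * T := mul_le_mul_of_nonneg_left ht.2 M.2
      have h4 := norm_le_norm_add_norm_sub' (piecewiseLinearInterp (α m) (x m) t) (x m 0)
      linarith)
  obtain ⟨m, hm⟩ := (Metric.tendstoUniformlyOn_iff.1 hy ε hε).exists
  obtain ⟨t, ht, hlt⟩ := hno (φ m) y (deriv y)
    ((intervalIntegrable_iff_integrableOn_Icc_of_le hT.le).1 (aux_ftc hyL 0 T).1)
    (fun t _ => by rw [(aux_ftc hyL 0 t).2]; simp)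
    (by
      rw [ae_restrict_iff' measurableSet_Ioo]
      filter_upwards [hyL.ae_differentiableAt_real] with t ht htT
      exact aux_deriv F hF_usc hF_cpt hF_cvx T M (fun m => α (φ m)) (fun m => hαpos _)
        (hα0.comp hφ.tendsto_atTop) (fun m => x (φ m)) (fun m => s (φ m)) (fun m => hxs _)
        (fun m => hsF _) (fun m => hs _) y hy t htT _ ht.hasDerivAt)
    (by
      refine hX₀.isClosed.mem_of_tendsto (hy.tendsto_at h0mem) (Eventually.of_forall fun m => ?_)
      rw [hzero]
      exact hx0 _)
  have := hm t ht
  rw [dist_comm, dist_eq_norm] at this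
  linarith
end

section
/- Let f : ℝⁿ → ℝ be locally Lipschitz, let x* ∈ ℝⁿ, and let G : ℝⁿ ⇉ ℝⁿ be an upper semicontinuous set-valued map with nonempty, compact, and convex values. Assume: (i) (Kurdyka–Łojasiewicz inequality) there exist r > 0, ρ > 0 and a strictly increasing, concave, continuous function ψ : [0, ρ) → [0, ∞) that is continuously differentiable on (0, ρ) with ψ(0) = 0, such that dist(0, G(x)) ≥ 1/ψ′(|f(x) − f(x*)|) for all x ∈ B(x*, r) with 0 < |f(x) − f(x*)| < ρ; (ii) (descent identity) every solution x : [0, T] → ℝⁿ of the differential inclusion x′(t) ∈ −G(x(t)) satisfies f(x(t)) − f(x(0)) = −∫₀ᵗ dist(0, G(x(τ)))² dτ for all t ∈ [0, T]. If x* is a stable point of the dynamics x_{k+1} ∈ x_k − α·G(x_k), then x* is a local minimum of f. -/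
open Metric Set MeasureTheory

open Filter Topology
open scoped NNReal

lemma lip_ftc {n : ℕ} {K : ℝ≥0} {x : ℝ → EuclideanSpace ℝ (Fin n)} (hx : LipschitzWith K x) (t : ℝ) :
    x t = x 0 + ∫ s in (0 : ℝ)..t, deriv x s := by
  have hint : IntervalIntegrable (deriv x) volume 0 t := by
    refine (intervalIntegrable_const (c := (K : ℝ))).mono_fun (measurable_deriv x).aestronglyMeasurable ?_
    refine Eventually.of_forall fun s => ?_
    have := norm_deriv_le_of_lipschitz hx (x₀ := s)
    simpa using this
  ext i
  let P : EuclideanSpace ℝ (Fin n) →L[ℝ] ℝ := EuclideanSpace.proj i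
  have h1 : ∫ s in (0 : ℝ)..t, P (deriv x s) = P (∫ s in (0 : ℝ)..t, deriv x s) :=
    P.intervalIntegral_comp_comm hint
  have hl : LipschitzWith (‖P‖₊ * K) (fun s => P (x s)) := P.lipschitz.comp hx
  have h2 := (hl.lipschitzOnWith (s := uIcc 0 t)).absolutelyContinuousOnInterval.integral_deriv_eq_sub
  have h3 : ∫ s in (0 : ℝ)..t, deriv (fun s => P (x s)) s = ∫ s in (0 : ℝ)..t, P (deriv x s) := by
    apply intervalIntegral.integral_congr_ae
    filter_upwards [hx.ae_differentiableAt_real] with s hs _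
    exact (P.hasFDerivAt.comp_hasDerivAt s hs.hasDerivAt).deriv
  have h4 : P (x t) = P (x 0) + P (∫ s in (0 : ℝ)..t, deriv x s) := by linarith
  simpa [P] using h4

lemma floor_diff (s t a : ℝ) (ha : 0 < a) (hst : s ≤ t) :
    ((⌊t / a⌋₊ : ℝ) - ⌊s / a⌋₊) * a ≤ (t - s) + a := by
  rcases le_or_gt 0 t with ht | ht
  · have h1 := Nat.floor_le (div_nonneg ht ha.le)
    have h2 := Nat.lt_floor_add_one (s / a)
    have h3 : (⌊t / a⌋₊ : ℝ) - ⌊s / a⌋₊ ≤ t / a - s / a + 1 := by linarith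
    calc _ ≤ (t / a - s / a + 1) * a := by gcongr
      _ = _ := by field_simp
  · rw [Nat.floor_of_nonpos (div_nonpos_of_nonpos_of_nonneg ht.le ha.le),
      Nat.floor_of_nonpos (div_nonpos_of_nonpos_of_nonneg (hst.trans ht.le) ha.le)]
    simp; linarith

lemma avg_mem {E : Type*} [NormedAddCommGroup E] [NormedSpace ℝ E] {C : Set E} (hC : Convex ℝ C)
    (u : ℕ → E) (a : ℝ) (ha : 0 < a) (k m : ℕ) (hm : 0 < m)
    (h : ∀ j, k ≤ j → j < k + m → ∃ s ∈ C, u (j + 1) = u j - a • s) :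
    ((m : ℝ) * a)⁻¹ • (u k - u (k + m)) ∈ C := by
  have hs : ∀ j, ∃ s, j < m → s ∈ C ∧ u (k + j + 1) = u (k + j) - a • s := by
    intro j
    by_cases hj : j < m
    · obtain ⟨s, h1, h2⟩ := h (k + j) (by lia) (by lia)
      exact ⟨s, fun _ => ⟨h1, h2⟩⟩
    · exact ⟨0, fun h => absurd h hj⟩
  choose s hs using hs
  have hsum : u k - u (k + m) = ∑ j ∈ Finset.range m, a • s j := by
    have := Finset.sum_range_sub' (fun j => u (k + j)) m
    simp only [add_zero] at this
    rw [← this]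
    refine Finset.sum_congr rfl fun j hj => ?_
    have := (hs j (Finset.mem_range.1 hj)).2
    rw [← add_assoc, this]; abel
  have hm' : (m : ℝ) ≠ 0 := by positivity
  rw [hsum, Finset.smul_sum]
  have : ∀ j, ((m : ℝ) * a)⁻¹ • a • s j = (m : ℝ)⁻¹ • s j := by
    intro j; rw [smul_smul]; congr 1; field_simp
  simp only [this]
  refine hC.sum_mem (fun _ _ => by positivity) (by simp [hm']) fun j hj => (hs j (Finset.mem_range.1 hj)).1

lemma step_lip {E : Type*} [NormedAddCommGroup E] [NormedSpace ℝ E]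
    (u : ℕ → E) (a L : ℝ) (ha : 0 < a) (h : ∀ j, ∃ s, ‖s‖ ≤ L ∧ u (j + 1) = u j - a • s) (k m : ℕ)
    (hkm : k ≤ m) : ‖u m - u k‖ ≤ L * (((m : ℝ) - k) * a) := by
  induction m, hkm using Nat.le_induction with
  | base => simp
  | succ m hm ih =>
    obtain ⟨s, hs, e⟩ := h m
    rw [e]
    calc ‖u m - a • s - u k‖ = ‖(u m - u k) - a • s‖ := by congr 1; abel
      _ ≤ ‖u m - u k‖ + ‖a • s‖ := norm_sub_le _ _
      _ ≤ L * (((m : ℝ) - k) * a) + a * L := by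
        rw [norm_smul, Real.norm_of_nonneg ha.le]; gcongr
      _ = _ := by push_cast; ring

lemma euler_limit {n : ℕ} (G : EuclideanSpace ℝ (Fin n) → Set (EuclideanSpace ℝ (Fin n)))
    (hG_usc : ∀ x : EuclideanSpace ℝ (Fin n), ∀ U : Set (EuclideanSpace ℝ (Fin n)),
      IsOpen U → G x ⊆ U → ∃ δ > (0 : ℝ), ∀ y, ‖y - x‖ ≤ δ → G y ⊆ U)
    (hG_cpt : ∀ x, IsCompact (G x))
    (hG_cvx : ∀ x, Convex ℝ (G x)) (xs x0 : EuclideanSpace ℝ (Fin n)) (ε L : ℝ) (hL0 : 0 < L)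
    (hL : ∀ y ∈ closedBall xs ε, ∀ g ∈ G y, ‖g‖ ≤ L) (a : ℕ → ℝ) (ha : ∀ N, 0 < a N)
    (ha0 : Tendsto a atTop (𝓝 0)) (u : ℕ → ℕ → EuclideanSpace ℝ (Fin n))
    (hu0 : ∀ N, u N 0 = x0) (hu : ∀ N k, ∃ s ∈ G (u N k), u N (k + 1) = u N k - a N • s)
    (hmem : ∀ N k, u N k ∈ closedBall xs ε) :
    ∃ x : ℝ → EuclideanSpace ℝ (Fin n), x 0 = x0 ∧ LipschitzWith L.toNNReal x ∧
      (∀ t, x t ∈ closedBall xs ε) ∧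
      ∀ t > 0, DifferentiableAt ℝ x t → deriv x t ∈ -G (x t) := by
  let F : Ultrafilter ℕ := hyperfilter ℕ
  have hF : (F : Filter ℕ) ≤ atTop := Nat.hyperfilter_le_atTop
  have haF : Tendsto a F (𝓝 0) := ha0.mono_left hF
  let y : ℕ → ℝ → EuclideanSpace ℝ (Fin n) := fun N t => u N ⌊t / a N⌋₊
  have hlim : ∀ t, ∃ z ∈ closedBall xs ε, Tendsto (fun N => y N t) F (𝓝 z) := by
    intro t
    have := (isCompact_closedBall xs ε).ultrafilter_le_nhds (F.map fun N => y N t)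
      (by
        rw [le_principal_iff]
        exact Eventually.of_forall (f := (F : Filter ℕ)) fun N => hmem N _)
    exact this
  choose x hxm hx using hlim
  have hlip : ∀ N k m, k ≤ m → ‖u N m - u N k‖ ≤ L * (((m : ℝ) - k) * a N) := fun N k m hkm =>
    step_lip (u N) (a N) L (ha N)
      (fun j => (hu N j).imp fun s hs => ⟨hL _ (hmem N j) s hs.1, hs.2⟩) k m hkm
  have hfm : ∀ N s t, s ≤ t → ⌊s / a N⌋₊ ≤ ⌊t / a N⌋₊ := fun N s t hst =>
    Nat.floor_le_floor (div_le_div_of_nonneg_right hst (ha N).le)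
  have hylip : ∀ N s t, s ≤ t → ‖y N t - y N s‖ ≤ L * ((t - s) + a N) := by
    intro N s t hst
    refine (hlip N _ _ (hfm N s t hst)).trans ?_
    have := floor_diff s t (a N) (ha N) hst
    gcongr
  have hxlip : ∀ s t, s ≤ t → ‖x t - x s‖ ≤ L * (t - s) := by
    intro s t hst
    have h1 : Tendsto (fun N => ‖y N t - y N s‖) F (𝓝 ‖x t - x s‖) := ((hx t).sub (hx s)).norm
    have h2 : Tendsto (fun N => L * ((t - s) + a N)) F (𝓝 (L * ((t - s) + 0))) :=
      (haF.const_add _).const_mul _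
    rw [add_zero] at h2
    exact le_of_tendsto_of_tendsto h1 h2 (Eventually.of_forall fun N => hylip N s t hst)
  refine ⟨x, ?_, ?_, hxm, ?_⟩
  · refine tendsto_nhds_unique (hx 0) ?_
    simp [y, hu0]
  · refine LipschitzWith.of_dist_le_mul fun s t => ?_
    rw [Real.coe_toNNReal _ hL0.le]
    rcases le_total s t with h | h
    · rw [dist_comm, dist_eq_norm, dist_comm, Real.dist_eq, abs_of_nonneg (by linarith)]
      exact hxlip s t h
    · rw [dist_eq_norm, Real.dist_eq, abs_of_nonneg (by linarith)]
      exact hxlip t s h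
  intro t ht hd
  have key : ∀ η > (0:ℝ), -deriv x t ∈ cthickening η (G (x t)) := by
    intro η hη
    obtain ⟨δ, hδ, hδG⟩ := hG_usc (x t) (thickening η (G (x t))) isOpen_thickening
      (self_subset_thickening hη _)
    set C := thickening η (G (x t)) with hC
    have hCc : Convex ℝ C := (hG_cvx _).thickening η
    have hsmall : ∀ h, 0 < h → L * h < δ / 2 → h⁻¹ • (x t - x (t + h)) ∈ cthickening η (G (x t)) := by
      intro h hh hLh
      let m : ℕ → ℕ := fun N => ⌊(t + h) / a N⌋₊ - ⌊t / a N⌋₊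
      have hmc : ∀ N, (m N : ℝ) = (⌊(t + h) / a N⌋₊ : ℝ) - ⌊t / a N⌋₊ := fun N => by
        simp only [m]; rw [Nat.cast_sub (hfm N _ _ (by linarith))]
      have hmlow : ∀ N, h - a N ≤ m N * a N := by
        intro N
        have h1 := Nat.floor_le (div_nonneg ht.le (ha N).le)
        have h2 := Nat.lt_floor_add_one ((t + h) / a N)
        rw [hmc]
        have : (t + h) / a N - t / a N - 1 ≤ (⌊(t + h) / a N⌋₊ : ℝ) - ⌊t / a N⌋₊ := by linarith
        have h3 := mul_le_mul_of_nonneg_right this (ha N).le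
        have hne := (ha N).ne'
        calc h - a N = ((t + h) / a N - t / a N - 1) * a N := by field_simp; ring
          _ ≤ _ := h3
      have hmup : ∀ N, m N * a N ≤ h + a N := by
        intro N
        rw [hmc]
        have := floor_diff t (t + h) (a N) (ha N) (by linarith)
        linarith
      have hml : Tendsto (fun N => (m N : ℝ) * a N) F (𝓝 h) := by
        refine tendsto_of_tendsto_of_tendsto_of_le_of_le ?_ ?_ hmlow hmup
        · simpa using haF.const_sub h
        · simpa using haF.const_add h
      have hl : Tendsto (fun N => ((m N : ℝ) * a N)⁻¹ • (y N t - y N (t + h))) F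
          (𝓝 (h⁻¹ • (x t - x (t + h)))) := (hml.inv₀ hh.ne').smul ((hx t).sub (hx (t + h)))
      refine (isClosed_cthickening).mem_of_tendsto hl ?_
      have e1 : ∀ᶠ N in F, ‖y N t - x t‖ < δ / 4 := by
        have := (tendsto_iff_norm_sub_tendsto_zero.1 (hx t))
        exact this.eventually_lt_const (by positivity)
      have e2 : ∀ᶠ N in F, L * a N < δ / 4 := by
        have := haF.const_mul L
        rw [mul_zero] at this
        exact this.eventually_lt_const (by positivity)
      have e3 : ∀ᶠ N in F, 0 < (m N : ℝ) * a N := hml.eventually_const_lt hh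
      filter_upwards [e1, e2, e3] with N h1 h2 h3
      refine thickening_subset_cthickening _ _ ?_
      have hm0 : 0 < m N := by
        rcases Nat.eq_zero_or_pos (m N) with h0 | h0
        · simp [h0] at h3
        · exact h0
      have hend : y N (t + h) = u N (⌊t / a N⌋₊ + m N) := by
        simp only [y, m]; rw [Nat.add_sub_cancel' (hfm N _ _ (by linarith))]
      rw [hend]
      refine avg_mem hCc (u N) (a N) (ha N) _ _ hm0 fun j hj1 hj2 => ?_
      obtain ⟨s, hs, e⟩ := hu N j
      refine ⟨s, hδG _ ?_ hs, e⟩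
      have q1 := hlip N _ j hj1
      have q2 : ((j : ℝ) - ⌊t / a N⌋₊) * a N ≤ h + a N := by
        refine le_trans ?_ (hmup N)
        have : (j : ℝ) ≤ ⌊t / a N⌋₊ + m N := by exact_mod_cast hj2.le
        have := ha N
        gcongr
        linarith
      have q3 : ‖u N j - y N t‖ ≤ L * (h + a N) := q1.trans (by gcongr)
      calc ‖u N j - x t‖ ≤ ‖u N j - y N t‖ + ‖y N t - x t‖ := norm_sub_le_norm_sub_add_norm_sub _ _ _
        _ ≤ δ := by nlinarith
    have hts := hd.hasDerivAt.tendsto_slope_zero_right.neg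
    refine isClosed_cthickening.mem_of_tendsto hts ?_
    have e4 : ∀ᶠ h in 𝓝[>] (0:ℝ), L * h < δ / 2 := by
      have : Tendsto (fun h : ℝ => L * h) (𝓝 0) (𝓝 (L * 0)) := tendsto_id.const_mul L
      rw [mul_zero] at this
      exact (this.mono_left nhdsWithin_le_nhds).eventually_lt_const (by positivity)
    filter_upwards [e4, self_mem_nhdsWithin] with h h1 h2
    rw [← smul_neg, neg_sub]
    exact hsmall h h2 h1
  rw [Set.mem_neg, ← (hG_cpt (x t)).isClosed.closure_eq, closure_eq_iInter_cthickening]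
  simpa using key

lemma infDist_lsc {n : ℕ} (G : EuclideanSpace ℝ (Fin n) → Set (EuclideanSpace ℝ (Fin n)))
    (hG_usc : ∀ x : EuclideanSpace ℝ (Fin n), ∀ U : Set (EuclideanSpace ℝ (Fin n)),
      IsOpen U → G x ⊆ U → ∃ δ > (0 : ℝ), ∀ y, ‖y - x‖ ≤ δ → G y ⊆ U)
    (hG_ne : ∀ x, (G x).Nonempty) : LowerSemicontinuous fun y => infDist 0 (G y) := by
  intro y a hya
  obtain ⟨b, hab, hb⟩ := exists_between hya
  obtain ⟨δ, hδ, h⟩ := hG_usc y {z | b < ‖z‖} (isOpen_lt continuous_const continuous_norm) (by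
    intro z hz
    have := infDist_le_dist_of_mem (x := 0) hz
    rw [dist_zero_left] at this
    exact lt_of_lt_of_le hb this)
  filter_upwards [closedBall_mem_nhds y hδ] with z hz
  refine lt_of_lt_of_le hab ((le_infDist (hG_ne z)).2 fun w hw => ?_)
  rw [dist_zero_left]
  exact (h z (by rwa [← dist_eq_norm]) hw).le

lemma psi_deriv_pos {ρ : ℝ} {ψ ψ' : ℝ → ℝ} (hψ_mono : StrictMonoOn ψ (Set.Ico 0 ρ))
    (hψ_conc : ConcaveOn ℝ (Set.Ico 0 ρ) ψ)
    (hψ_deriv : ∀ s ∈ Set.Ioo (0 : ℝ) ρ, HasDerivAt ψ (ψ' s) s) :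
    ∀ s ∈ Set.Ioo (0 : ℝ) ρ, 0 < ψ' s := by
  intro s hs
  obtain ⟨t, ht1, ht2⟩ := exists_between hs.2
  have h1 : s ∈ Set.Ico 0 ρ := ⟨hs.1.le, hs.2⟩
  have h2 : t ∈ Set.Ico 0 ρ := ⟨(hs.1.trans ht1).le, ht2⟩
  have h3 := hψ_conc.slope_le_of_hasDerivAt h1 h2 ht1 (hψ_deriv s hs)
  refine lt_of_lt_of_le ?_ h3
  rw [slope_def_field]
  exact div_pos (sub_pos.2 (hψ_mono h1 h2 ht1)) (sub_pos.2 ht1)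

/-- Stable points of the discrete dynamics `x_{k+1} ∈ x_k - α • G(x_k)` of a set-valued map
`G` with constant step size, in the sense of discrete Lyapunov stability, are local minima of
`f`, provided `f` is locally Lipschitz, `G` is upper semicontinuous with nonempty compact
convex values, the Kurdyka–Łojasiewicz inequality holds near `x*`, and solutions of the
differential inclusion `x' ∈ -G(x)` satisfy the descent identity. -/
theorem stable_is_local_min {n : ℕ}
    (f : EuclideanSpace ℝ (Fin n) → ℝ) (hf : LocallyLipschitz f)
    (xs : EuclideanSpace ℝ (Fin n))
    (G : EuclideanSpace ℝ (Fin n) → Set (EuclideanSpace ℝ (Fin n)))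
    -- G is upper semicontinuous with nonempty compact convex values
    (hG_usc : ∀ x : EuclideanSpace ℝ (Fin n), ∀ U : Set (EuclideanSpace ℝ (Fin n)),
      IsOpen U → G x ⊆ U → ∃ δ > (0 : ℝ), ∀ y, ‖y - x‖ ≤ δ → G y ⊆ U)
    (hG_ne : ∀ x, (G x).Nonempty)
    (hG_cpt : ∀ x, IsCompact (G x))
    (hG_cvx : ∀ x, Convex ℝ (G x))
    -- (i) Kurdyka–Łojasiewicz inequality: ψ : [0, ρ) → [0, ∞) strictly increasing, concave,
    -- continuous, continuously differentiable on (0, ρ) with derivative ψ', ψ(0) = 0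
    (r ρ : ℝ) (hr : 0 < r) (hρ : 0 < ρ)
    (ψ ψ' : ℝ → ℝ)
    (hψ_mono : StrictMonoOn ψ (Set.Ico 0 ρ))
    (hψ_conc : ConcaveOn ℝ (Set.Ico 0 ρ) ψ)
    (hψ_cont : ContinuousOn ψ (Set.Ico 0 ρ))
    (hψ_nonneg : ∀ s ∈ Set.Ico (0 : ℝ) ρ, 0 ≤ ψ s)
    (hψ_zero : ψ 0 = 0)
    (hψ_deriv : ∀ s ∈ Set.Ioo (0 : ℝ) ρ, HasDerivAt ψ (ψ' s) s)
    (hψ'_cont : ContinuousOn ψ' (Set.Ioo 0 ρ))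
    (hKL : ∀ x ∈ closedBall xs r, 0 < |f x - f xs| → |f x - f xs| < ρ →
      infDist 0 (G x) ≥ 1 / ψ' |f x - f xs|)
    -- (ii) descent identity along solutions of the differential inclusion x' ∈ -G(x)
    (hdescent : ∀ T > (0 : ℝ), ∀ x v : ℝ → EuclideanSpace ℝ (Fin n),
      IntegrableOn v (Set.Icc 0 T) →
      (∀ t ∈ Set.Icc (0 : ℝ) T, x t = x 0 + ∫ s in (0 : ℝ)..t, v s) →
      (∀ᵐ t ∂(volume.restrict (Set.Ioo (0 : ℝ) T)), v t ∈ -G (x t)) →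
      ∀ t ∈ Set.Icc (0 : ℝ) T,
        f (x t) - f (x 0) = -∫ τ in (0 : ℝ)..t, (infDist 0 (G (x τ))) ^ 2)
    -- x* is a stable point of the dynamics x_{k+1} ∈ x_k - α • G(x_k)
    (hstable : ∀ ε > (0 : ℝ), ∃ δ > (0 : ℝ), ∃ ᾱ > (0 : ℝ), ∀ α ∈ Set.Ioc (0 : ℝ) ᾱ,
      ∀ x : ℕ → EuclideanSpace ℝ (Fin n), x 0 ∈ closedBall xs δ →
        (∀ k : ℕ, ∃ s ∈ G (x k), x (k + 1) = x k - α • s) →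
        ∀ k : ℕ, x k ∈ closedBall xs ε) :
    -- conclusion: x* is a local minimum of f
    ∃ ε > (0 : ℝ), ∀ x ∈ closedBall xs ε, f xs ≤ f x := by
  have hfc : Continuous f := hf.continuous
  obtain ⟨ε₁, hε₁, hfb⟩ : ∃ ε₁ > (0:ℝ), ∀ y ∈ closedBall xs ε₁, |f y - f xs| ≤ ρ / 2 := by
    obtain ⟨d, hd, h⟩ := Metric.continuous_iff.1 hfc xs (ρ / 2) (by positivity)
    refine ⟨d / 2, by positivity, fun y hy => ?_⟩
    have := h y (lt_of_le_of_lt (mem_closedBall.1 hy) (by linarith))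
    rw [Real.dist_eq] at this
    exact this.le
  obtain ⟨L, hL0, hLG⟩ : ∃ L > (0:ℝ), G xs ⊆ ball 0 L :=
    (hG_cpt xs).isBounded.subset_ball_lt 0 0
  obtain ⟨ε₂, hε₂, hLb⟩ := hG_usc xs _ isOpen_ball hLG
  let ε := min r (min ε₁ ε₂)
  have hε : 0 < ε := lt_min hr (lt_min hε₁ hε₂)
  have hL : ∀ y ∈ closedBall xs ε, ∀ g ∈ G y, ‖g‖ ≤ L := by
    intro y hy g hg
    have h1 : ‖y - xs‖ ≤ ε₂ := by
      rw [← dist_eq_norm]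
      exact (mem_closedBall.1 hy).trans ((min_le_right _ _).trans (min_le_right _ _))
    exact (mem_ball_zero_iff.1 (hLb y h1 hg)).le
  have hfb' : ∀ y ∈ closedBall xs ε, |f y - f xs| ≤ ρ / 2 := fun y hy =>
    hfb y (closedBall_subset_closedBall ((min_le_right _ _).trans (min_le_left _ _)) hy)
  obtain ⟨δ, hδ, α, hα, hst⟩ := hstable ε hε
  refine ⟨δ, hδ, fun x0 hx0 => ?_⟩
  by_contra! hlt
  choose g hg using hG_ne
  let a : ℕ → ℝ := fun N => α / (N + 1)
  have ha : ∀ N, 0 < a N := fun N => by positivity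
  have ha0 : Tendsto a atTop (𝓝 0) := by
    have := (tendsto_one_div_add_atTop_nhds_zero_nat (𝕜 := ℝ)).const_mul α
    simpa [a, div_eq_mul_inv] using this
  let u : ℕ → ℕ → EuclideanSpace ℝ (Fin n) := fun N k => (fun z => z - a N • g z)^[k] x0
  have hu : ∀ N k, ∃ s ∈ G (u N k), u N (k + 1) = u N k - a N • s := fun N k =>
    ⟨g (u N k), hg _, Function.iterate_succ_apply' _ _ _⟩
  have haα : ∀ N, a N ≤ α := fun N => div_le_self hα.le (by
    have : (0:ℝ) ≤ N := Nat.cast_nonneg N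
    linarith)
  obtain ⟨x, hx00, hxlip, hxm, hxd⟩ := euler_limit G hG_usc hG_cpt hG_cvx xs x0 ε L hL0 hL a ha ha0 u
    (fun N => rfl) hu (fun N => hst (a N) ⟨ha N, haα N⟩ (u N) hx0 (hu N))
  have hbd : ∀ s, ‖deriv x s‖ ≤ L := fun s => by
    have := norm_deriv_le_of_lipschitz hxlip (x₀ := s)
    rwa [Real.coe_toNNReal _ hL0.le] at this
  have hdes : ∀ t > (0:ℝ), f (x t) - f x0 = -∫ τ in (0 : ℝ)..t, (infDist 0 (G (x τ))) ^ 2 := by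
    intro t ht
    rw [← hx00]
    refine hdescent t ht x (deriv x) ?_ (fun s _ => lip_ftc hxlip s) ?_ t ⟨ht.le, le_rfl⟩
    · exact Measure.integrableOn_of_bounded (M := L) (by simp)
        (measurable_deriv x).aestronglyMeasurable (Eventually.of_forall hbd)
    · rw [ae_restrict_iff' measurableSet_Ioo]
      filter_upwards [hxlip.ae_differentiableAt_real] with s hs hs'
      exact hxd s hs'.1 hs
  have hx0m : x0 ∈ closedBall xs ε := hx00 ▸ hxm 0
  set c := f xs - f x0 with hc
  have hc0 : 0 < c := by linarith
  have hle : ∀ t, 0 ≤ t → f (x t) ≤ f x0 := by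
    intro t ht
    rcases ht.eq_or_lt with rfl | ht
    · rw [hx00]
    have h1 := hdes t ht
    have : 0 ≤ ∫ τ in (0 : ℝ)..t, (infDist 0 (G (x τ))) ^ 2 :=
      intervalIntegral.integral_nonneg ht.le fun _ _ => by positivity
    linarith
  have hpos := psi_deriv_pos hψ_mono hψ_conc hψ_deriv
  obtain ⟨M, hM⟩ := (isCompact_Icc (a := c) (b := ρ / 2)).bddAbove_image
    (hψ'_cont.mono fun s hs => ⟨hc0.trans_le hs.1, hs.2.trans_lt (by linarith)⟩)
  have hcmem : ∀ t, 0 ≤ t → |f (x t) - f xs| ∈ Set.Icc c (ρ / 2) := by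
    intro t ht
    refine ⟨?_, hfb' _ (hxm t)⟩
    have := hle t ht
    have h2 := neg_le_abs (f (x t) - f xs)
    linarith
  have hM0 : 0 < M := by
    have h0 := hcmem 0 le_rfl
    have := hM (mem_image_of_mem _ h0)
    exact (hpos _ ⟨hc0.trans_le h0.1, h0.2.trans_lt (by linarith)⟩).trans_le this
  have hlow : ∀ t, 0 ≤ t → 1 / M ≤ infDist 0 (G (x t)) := by
    intro t ht
    have h0 := hcmem t ht
    have h1 := hKL (x t) (closedBall_subset_closedBall (min_le_left _ _) (hxm t))
      (hc0.trans_le h0.1) (h0.2.trans_lt (by linarith))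
    refine le_trans ?_ h1
    exact one_div_le_one_div_of_le (hpos _ ⟨hc0.trans_le h0.1, h0.2.trans_lt (by linarith)⟩)
      (hM (mem_image_of_mem _ h0))
  have hup : ∀ t, infDist 0 (G (x t)) ≤ L := by
    intro t
    have := infDist_le_dist_of_mem (x := 0) (hg (x t))
    rw [dist_zero_left] at this
    exact this.trans (hL _ (hxm t) _ (hg _))
  have hmeas : Measurable fun τ => (infDist 0 (G (x τ))) ^ 2 :=
    ((infDist_lsc G hG_usc (fun z => ⟨g z, hg z⟩)).measurable.comp hxlip.continuous.measurable).pow_const 2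
  let T : ℝ := ρ * M ^ 2
  have hT : 0 < T := by positivity
  have hint : IntervalIntegrable (fun τ => (infDist 0 (G (x τ))) ^ 2) volume 0 T := by
    refine (intervalIntegrable_const (c := L ^ 2)).mono_fun hmeas.aestronglyMeasurable
      (Eventually.of_forall fun s => ?_)
    have h0 : 0 ≤ infDist 0 (G (x s)) := infDist_nonneg
    have := hup s
    simp only [norm_pow, Real.norm_of_nonneg h0, Real.norm_of_nonneg hL0.le]
    gcongr
  have hge : T * (1 / M) ^ 2 ≤ ∫ τ in (0 : ℝ)..T, (infDist 0 (G (x τ))) ^ 2 := by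
    have := intervalIntegral.integral_mono_on hT.le (intervalIntegrable_const (c := (1 / M) ^ 2))
      hint (fun s hs => by
        have := hlow s hs.1
        gcongr)
    simpa using this
  have e1 : T * (1 / M) ^ 2 = ρ := by simp only [T]; field_simp
  have e2 := hdes T hT
  have e3 := neg_le_abs (f (x T) - f xs)
  have e4 := hfb' _ (hxm T)
  linarith
end

section
/- Let f : ℝⁿ → ℝ be locally Lipschitz, let x* ∈ ℝⁿ, and let G : ℝⁿ ⇉ ℝⁿ be an upper semicontinuous set-valued map with nonempty, compact, and convex values. Assume: (i) (Łojasiewicz growth) there exist r > 0 and a strictly increasing continuous function σ : [0, ∞) → [0, ∞) with σ(0) = 0 such that f(x) − f(x*) ≥ σ(‖x − x*‖) for all x ∈ B(x*, r); (ii) (Kurdyka–Łojasiewicz inequality) there exists a strictly increasing, concave, continuous function ψ : [0, ρ) → [0, ∞) for some ρ > 0, continuously differentiable on (0, ρ) with ψ(0) = 0, such that dist(0, G(x)) ≥ 1/ψ′(f(x) − f(x*)) for all x ∈ B(x*, r) with 0 < f(x) − f(x*) < ρ; (iii) (descent identity) every solution x : [0, T] → ℝⁿ of the differential inclusion x′(t)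 ∈ −G(x(t)) satisfies f(x(t)) − f(x(0)) = −∫₀ᵗ dist(0, G(x(τ)))² dτ for all t ∈ [0, T]. Then x* is a stable point of the dynamics x_{k+1} ∈ x_k − α·G(x_k). -/
open Metric Set MeasureTheory
open Filter Topology

theorem ftc_lip {n : ℕ} (X : ℝ → EuclideanSpace ℝ (Fin n)) (C : NNReal) (hX : LipschitzWith C X)
    (a b : ℝ) : IntervalIntegrable (deriv X) volume a b ∧
      ∫ t in a..b, deriv X t = X b - X a := by
  have hI : ∀ a b : ℝ, IntervalIntegrable (deriv X) volume a b := by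
    intro a b
    refine (intervalIntegrable_const (c := (C : ℝ)) (μ := volume)).mono_fun' 
      (aestronglyMeasurable_deriv X _) ?_
    exact Eventually.of_forall fun t => norm_deriv_le_of_lipschitz hX
  refine ⟨hI a b, ?_⟩
  refine ext_inner_left ℝ fun w => ?_
  have h1 : LipschitzWith (‖innerSL ℝ w‖₊ * C) (fun t => innerSL ℝ w (X t)) :=
    (innerSL ℝ w).lipschitz.comp hX
  have h2 := (h1.lipschitzOnWith (s := uIcc a b)).absolutelyContinuousOnInterval.integral_deriv_eq_sub
  have h3 := (innerSL ℝ w).intervalIntegral_comp_comm (hI a b)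
  simp only [innerSL_apply_apply] at h2 h3
  rw [← h3, inner_sub_right, ← h2]
  apply intervalIntegral.integral_congr_ae
  filter_upwards [hX.ae_differentiableAt_real] with t ht _
  exact (((innerSL ℝ w).hasFDerivAt.comp_hasDerivAt t ht.hasDerivAt).deriv).symm

theorem usc_bdd {n : ℕ} (G : EuclideanSpace ℝ (Fin n) → Set (EuclideanSpace ℝ (Fin n)))
    (hG_usc : ∀ x : EuclideanSpace ℝ (Fin n), ∀ U : Set (EuclideanSpace ℝ (Fin n)),
      IsOpen U → G x ⊆ U → ∃ δ > (0 : ℝ), ∀ y, ‖y - x‖ ≤ δ → G y ⊆ U)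
    (hG_cpt : ∀ x, IsCompact (G x)) (K : Set (EuclideanSpace ℝ (Fin n))) (hK : IsCompact K) :
    ∃ L > (0 : ℝ), ∀ x ∈ K, ∀ s ∈ G x, ‖s‖ ≤ L := by
  refine hK.induction_on (p := fun A => ∃ L > (0 : ℝ), ∀ x ∈ A, ∀ s ∈ G x, ‖s‖ ≤ L)
    ⟨1, one_pos, by simp⟩ ?_ ?_ ?_
  · rintro s t hst ⟨L, hL, h⟩
    exact ⟨L, hL, fun x hx => h x (hst hx)⟩
  · rintro s t ⟨L, hL, h⟩ ⟨L', hL', h'⟩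
    refine ⟨max L L', lt_max_of_lt_left hL, ?_⟩
    rintro x (hx | hx) u hu
    · exact (h x hx u hu).trans (le_max_left _ _)
    · exact (h' x hx u hu).trans (le_max_right _ _)
  · intro x hx
    obtain ⟨R, hR, hsub⟩ := (hG_cpt x).isBounded.subset_ball_lt 0 0
    obtain ⟨δ, hδ, h⟩ := hG_usc x _ isOpen_ball hsub
    refine ⟨closedBall x δ, mem_nhdsWithin_of_mem_nhds (closedBall_mem_nhds x hδ), R, hR, ?_⟩
    intro y hy s hs
    have := h y (by simpa [dist_eq_norm] using hy) hs
    simpa using (mem_ball_zero_iff.1 this).le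

theorem lsc_infDist {n : ℕ} (G : EuclideanSpace ℝ (Fin n) → Set (EuclideanSpace ℝ (Fin n)))
    (hG_usc : ∀ x : EuclideanSpace ℝ (Fin n), ∀ U : Set (EuclideanSpace ℝ (Fin n)),
      IsOpen U → G x ⊆ U → ∃ δ > (0 : ℝ), ∀ y, ‖y - x‖ ≤ δ → G y ⊆ U)
    (hG_ne : ∀ x, (G x).Nonempty) :
    LowerSemicontinuous (fun x => infDist 0 (G x)) := by
  intro x c hc
  obtain ⟨c', hc1, hc2⟩ := exists_between hc
  obtain ⟨δ, hδ, h⟩ := hG_usc x {s | c' < ‖s‖} (isOpen_lt continuous_const continuous_norm)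
    (by
      intro s hs
      have := infDist_le_dist_of_mem (x := 0) hs
      rw [dist_zero_left] at this
      exact lt_of_lt_of_le hc2 this)
  filter_upwards [closedBall_mem_nhds x hδ] with y hy
  have h2 := h y (by simpa [dist_eq_norm] using hy)
  refine lt_of_lt_of_le hc1 ?_
  rw [le_infDist (hG_ne y)]
  intro s hs
  rw [dist_zero_left]
  exact (h2 hs).le

theorem traj_avg {E : Type*} [NormedAddCommGroup E] [NormedSpace ℝ E] (U : Set E) (hU : Convex ℝ U)
    (α : ℝ) (x s : ℕ → E) (hx : ∀ k, x (k + 1) = x k - α • s k) (a m : ℕ)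
    (hs : ∀ k, a ≤ k → k < a + (m + 1) → s k ∈ U) :
    ∃ u ∈ U, x (a + (m + 1)) - x a = -((α * (m + 1 : ℝ)) • u) := by
  induction m with
  | zero => 
    refine ⟨s a, hs a le_rfl (by omega), ?_⟩
    have := hx a
    simp [this]
  | succ m ih =>
    obtain ⟨u, hu, h⟩ := ih (fun k h1 h2 => hs k h1 (by omega))
    have hm : (0 : ℝ) < (m : ℝ) + 2 := by positivity
    refine ⟨((m + 1 : ℝ) / (m + 2)) • u + ((1 : ℝ) / (m + 2)) • s (a + (m + 1)),
      hU hu (hs _ (by omega) (by omega)) (by positivity) (by positivity) (by field_simp; ring), ?_⟩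
    have h1 := hx (a + (m + 1))
    have h2 : x (a + (m + 1 + 1)) - x a = (x (a + (m + 1)) - x a) - α • s (a + (m + 1)) := by
      rw [show a + (m + 1 + 1) = a + (m + 1) + 1 by ring, h1]; abel
    rw [h2, h, smul_add, smul_smul, smul_smul]
    have e1 : α * ((m + 1 : ℕ) + 1 : ℝ) * ((m + 1 : ℝ) / (m + 2)) = α * (m + 1) := by
      push_cast; field_simp; ring
    have e2 : α * ((m + 1 : ℕ) + 1 : ℝ) * ((1 : ℝ) / (m + 2)) = α := by
      push_cast; field_simp; ring
    rw [e1, e2]; abel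

theorem traj_bound {E : Type*} [NormedAddCommGroup E] [NormedSpace ℝ E] (G : E → Set E) (xs : E)
    (R R' L T α : ℝ) (hL : 0 ≤ L) (hα : 0 ≤ α)
    (hG : ∀ x ∈ closedBall xs R', ∀ s ∈ G x, ‖s‖ ≤ L) (hT : R + L * T ≤ R')
    (x s : ℕ → E) (h0 : x 0 ∈ closedBall xs R) (hsG : ∀ k, s k ∈ G (x k))
    (hx : ∀ k, x (k + 1) = x k - α • s k) :
    (∀ k : ℕ, α * k ≤ T → x k ∈ closedBall xs R') ∧
    (∀ i k : ℕ, i ≤ k → α * k ≤ T → ‖x k - x i‖ ≤ L * (α * k - α * i)) := by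
  have key : ∀ k : ℕ, α * k ≤ T → x k ∈ closedBall xs (R + L * (α * k)) := by
    intro k
    induction k with
    | zero => intro _; simpa using h0
    | succ k ih =>
      intro hk
      push_cast at hk
      have hk' : α * k ≤ T := by nlinarith
      have h1 := ih hk'
      have h2 : x k ∈ closedBall xs R' :=
        closedBall_subset_closedBall (by nlinarith [mul_le_mul_of_nonneg_left hk' hL]) h1
      have h3 := hG _ h2 _ (hsG k)
      rw [mem_closedBall, dist_eq_norm] at h1 ⊢
      have h4 : x (k + 1) - xs = (x k - xs) - α • s k := by rw [hx]; abel
      rw [h4]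
      refine (norm_sub_le _ _).trans ?_
      rw [norm_smul, Real.norm_of_nonneg hα]
      push_cast
      nlinarith [mul_le_mul_of_nonneg_left h3 hα]
  have key2 : ∀ k : ℕ, α * k ≤ T → x k ∈ closedBall xs R' := fun k hk =>
    closedBall_subset_closedBall (by nlinarith [mul_le_mul_of_nonneg_left hk hL]) (key k hk)
  refine ⟨key2, ?_⟩
  intro i k hik
  induction k, hik using Nat.le_induction with
  | base => intro _; simp
  | succ k hik ih =>
    intro hk
    push_cast at hk
    have hk' : α * k ≤ T := by nlinarith
    have h1 := ih hk'
    have h3 := hG _ (key2 k hk') _ (hsG k)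
    have h4 : x (k + 1) - x i = (x k - x i) - α • s k := by rw [hx]; abel
    rw [h4]
    refine (norm_sub_le _ _).trans ?_
    rw [norm_smul, Real.norm_of_nonneg hα]
    push_cast
    nlinarith [mul_le_mul_of_nonneg_left h3 hα]

theorem limit_sol {n : ℕ} (G : EuclideanSpace ℝ (Fin n) → Set (EuclideanSpace ℝ (Fin n)))
    (hG_usc : ∀ x : EuclideanSpace ℝ (Fin n), ∀ U : Set (EuclideanSpace ℝ (Fin n)),
      IsOpen U → G x ⊆ U → ∃ δ > (0 : ℝ), ∀ y, ‖y - x‖ ≤ δ → G y ⊆ U)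
    (hG_cpt : ∀ x, IsCompact (G x))
    (hG_cvx : ∀ x, Convex ℝ (G x))
    (xs : EuclideanSpace ℝ (Fin n)) (R L T : ℝ) (hL : 0 < L) (hT : 0 < T)
    (α : ℕ → ℝ) (hα : ∀ j, 0 < α j) (hα0 : Tendsto α atTop (𝓝 0))
    (x s : ℕ → ℕ → EuclideanSpace ℝ (Fin n)) (hs : ∀ j k, s j k ∈ G (x j k))
    (hx : ∀ j k, x j (k + 1) = x j k - α j • s j k)
    (hball : ∀ j (k : ℕ), α j * k ≤ T → x j k ∈ closedBall xs R)
    (hlip : ∀ j (i k : ℕ), i ≤ k → α j * k ≤ T → ‖x j k - x j i‖ ≤ L * (α j * k - α j * i)) :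
    ∃ (F : Filter ℕ) (X : ℝ → EuclideanSpace ℝ (Fin n)), F.NeBot ∧ F ≤ atTop ∧
      (∃ C, LipschitzWith C X) ∧ (∀ t, X t ∈ closedBall xs R) ∧
      Tendsto (fun j => x j 0) F (𝓝 (X 0)) ∧
      Tendsto (fun j => x j ⌊T / α j⌋₊) F (𝓝 (X T)) ∧
      ∀ t ∈ Ioo 0 T, DifferentiableAt ℝ X t → -deriv X t ∈ G (X t) := by
  set c : ℝ → ℝ := fun t => max (min t T) 0 with hc
  have hc0 : ∀ t, 0 ≤ c t := fun t => le_max_right _ _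
  have hcT : ∀ t, c t ≤ T := fun t => max_le (min_le_right _ _) hT.le
  have hcm : ∀ t u, t ≤ u → c t ≤ c u := fun t u h => by
    simp only [hc]; gcongr
  have hcl : ∀ t u, t ≤ u → c u - c t ≤ u - t := fun t u h => by
    simp only [hc]
    rcases max_cases (min t T) 0 with h1 | h1 <;> rcases max_cases (min u T) 0 with h2 | h2 <;>
    rcases min_cases t T with h3 | h3 <;> rcases min_cases u T with h4 | h4 <;> linarith
  set N : ℕ → ℝ → ℕ := fun j t => ⌊c t / α j⌋₊ with hN
  have hN1 : ∀ j t, α j * N j t ≤ c t := fun j t => by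
    have := Nat.floor_le (div_nonneg (hc0 t) (hα j).le)
    rw [le_div_iff₀ (hα j)] at this
    rw [mul_comm]; exact this
  have hN2 : ∀ j t, c t - α j ≤ α j * N j t := fun j t => by
    have := Nat.lt_floor_add_one (c t / α j)
    rw [div_lt_iff₀ (hα j)] at this
    simp only [hN]
    linarith
  have hNm : ∀ j t u, t ≤ u → N j t ≤ N j u := fun j t u h =>
    Nat.floor_le_floor (div_le_div_of_nonneg_right (hcm t u h) (hα j).le)
  obtain ⟨F, hF⟩ : ∃ F : Ultrafilter ℕ, (F : Filter ℕ) ≤ atTop :=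
    ⟨Ultrafilter.of atTop, Ultrafilter.of_le atTop⟩
  have hlim : ∀ t, ∃ y ∈ closedBall xs R, Tendsto (fun j => x j (N j t)) F (𝓝 y) := by
    intro t
    have hmem : ∀ᶠ j in (F : Filter ℕ), x j (N j t) ∈ closedBall xs R :=
      Eventually.of_forall fun j => hball j _ ((hN1 j t).trans (hcT t))
    exact (isCompact_closedBall xs R).ultrafilter_le_nhds' (F.map (fun j => x j (N j t))) hmem
  choose X hXb hXt using hlim
  have hαF : Tendsto α F (𝓝 0) := hα0.mono_left hF
  have hαN : ∀ t, Tendsto (fun j => α j * N j t) F (𝓝 (c t)) := fun t => by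
    refine tendsto_of_tendsto_of_tendsto_of_le_of_le (g := fun j => c t - α j) (h := fun _ => c t)
      ?_ tendsto_const_nhds (fun j => hN2 j t) (fun j => hN1 j t)
    simpa using tendsto_const_nhds.sub hαF
  have hXl : ∀ t u, t ≤ u → ‖X u - X t‖ ≤ L * (u - t) := by
    intro t u htu
    have h1 : Tendsto (fun j => ‖x j (N j u) - x j (N j t)‖) F (𝓝 ‖X u - X t‖) :=
      ((hXt u).sub (hXt t)).norm
    have h2 : Tendsto (fun j => L * (α j * N j u - α j * N j t)) F (𝓝 (L * (c u - c t))) :=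
      ((hαN u).sub (hαN t)).const_mul L
    have h3 := le_of_tendsto_of_tendsto' h1 h2 (fun j => hlip j _ _ (hNm j t u htu)
      ((hN1 j u).trans (hcT u)))
    exact h3.trans (mul_le_mul_of_nonneg_left (hcl t u htu) hL.le)
  refine ⟨F, X, F.neBot, hF, ⟨L.toNNReal, ?_⟩, hXb, ?_, ?_, ?_⟩
  · refine LipschitzWith.of_dist_le_mul fun u t => ?_
    rw [Real.coe_toNNReal _ hL.le, dist_eq_norm, Real.dist_eq]
    rcases le_total t u with h | h
    · rw [abs_of_nonneg (by linarith)]; exact hXl t u h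
    · rw [abs_of_nonpos (by linarith), norm_sub_rev, neg_sub]; exact hXl u t h
  · have h := hXt 0
    have : ∀ j, N j 0 = 0 := fun j => by simp [hN, hc, hT.le]
    simpa [this] using h
  · have h := hXt T
    have : ∀ j, N j T = ⌊T / α j⌋₊ := fun j => by simp [hN, hc, hT.le]
    simpa [this] using h
  · intro t ht hd
    rw [← (hG_cpt (X t)).isClosed.closure_eq, closure_eq_iInter_cthickening]
    simp only [mem_iInter]
    intro η hη
    obtain ⟨δ, hδ, hU⟩ := hG_usc (X t) (thickening η (G (X t))) isOpen_thickening
      (self_subset_thickening hη _)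
    have hcv : Convex ℝ (cthickening η (G (X t))) := (hG_cvx (X t)).cthickening η
    have hslope := hd.hasDerivAt.tendsto_slope_zero_right.neg
    refine isClosed_cthickening.mem_of_tendsto hslope ?_
    have hh0 : 0 < min (T - t) (δ / (2 * L)) := lt_min (by linarith [ht.2]) (by positivity)
    filter_upwards [Ioo_mem_nhdsGT hh0] with h hh
    have hh1 : h < T - t := hh.2.trans_le (min_le_left _ _)
    have hh2 : L * h < δ / 2 := by
      have := hh.2.trans_le (min_le_right _ _)
      rw [lt_div_iff₀ (by positivity)] at this
      linarith
    have hhp : 0 < h := hh.1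
    have hct : c t = t := by simp [hc, ht.1.le, ht.2.le]
    have hcth : c (t + h) = t + h := by
      simp only [hc]
      rw [min_eq_left (by linarith), max_eq_left (by linarith [ht.1])]
    have hβ : Tendsto (fun j => α j * N j (t + h) - α j * N j t) F (𝓝 h) := by
      have := (hαN (t + h)).sub (hαN t)
      rwa [hct, hcth, add_sub_cancel_left] at this
    have hlimit : Tendsto (fun j => -((α j * N j (t + h) - α j * N j t)⁻¹ •
        (x j (N j (t + h)) - x j (N j t)))) F (𝓝 (-(h⁻¹ • (X (t + h) - X t)))) :=
      ((hβ.inv₀ hhp.ne').smul ((hXt (t + h)).sub (hXt t))).neg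
    refine isClosed_cthickening.mem_of_tendsto hlimit ?_
    have e1 : ∀ᶠ j in (F : Filter ℕ), 0 < α j * N j (t + h) - α j * N j t :=
      hβ.eventually (lt_mem_nhds hhp)
    have e2 : ∀ᶠ j in (F : Filter ℕ), L * (α j * N j (t + h) - α j * N j t) < δ / 2 :=
      (hβ.const_mul L).eventually (gt_mem_nhds hh2)
    have e3 : ∀ᶠ j in (F : Filter ℕ), x j (N j t) ∈ ball (X t) (δ / 2) :=
      (hXt t).eventually (ball_mem_nhds _ (by positivity))
    filter_upwards [e1, e2, e3] with j h1 h2 h3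
    have hlt : N j t < N j (t + h) := by
      have : (N j t : ℝ) < N j (t + h) := by
        by_contra hcon
        push Not at hcon
        have := mul_le_mul_of_nonneg_left hcon (hα j).le
        linarith
      exact_mod_cast this
    obtain ⟨m, hm⟩ : ∃ m, N j (t + h) = N j t + (m + 1) :=
      ⟨N j (t + h) - N j t - 1, by omega⟩
    obtain ⟨u, hu, hux⟩ := traj_avg (cthickening η (G (X t))) hcv (α j) (x j) (s j) (hx j)
      (N j t) m (by
        intro k hk1 hk2
        rw [← hm] at hk2
        apply thickening_subset_cthickening
        refine hU (x j k) ?_ (hs j k)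
        have hkk : α j * k ≤ α j * N j (t + h) :=
          mul_le_mul_of_nonneg_left (by exact_mod_cast hk2.le) (hα j).le
        have hl := hlip j _ k hk1 (hkk.trans ((hN1 j _).trans (hcT _)))
        have h4 : L * (α j * k - α j * N j t) ≤ L * (α j * N j (t + h) - α j * N j t) :=
          mul_le_mul_of_nonneg_left (by linarith) hL.le
        rw [mem_ball, dist_eq_norm] at h3
        have h5 : x j k - X t = (x j k - x j (N j t)) + (x j (N j t) - X t) := by abel
        rw [h5]
        refine (norm_add_le _ _).trans ?_
        linarith)
    have hb : α j * N j (t + h) - α j * N j t = α j * (m + 1 : ℝ) := by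
      rw [hm]; push_cast; ring
    rw [hb] at h1 ⊢
    rw [hm, hux, smul_neg, neg_neg, smul_smul, inv_mul_cancel₀ h1.ne', one_smul]
    exact hu

/-- If `f` is locally Lipschitz, `G` is upper semicontinuous with nonempty compact convex
values, `x*` satisfies the Łojasiewicz growth condition (so that `x*` is a strict local
minimum), the Kurdyka–Łojasiewicz inequality holds near `x*`, and solutions of the
differential inclusion `x' ∈ -G(x)` satisfy the descent identity, then `x*` is a stable
point of the discrete dynamics `x_{k+1} ∈ x_k - α • G(x_k)`. -/
theorem strict_local_min_is_stable {n : ℕ}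
    (f : EuclideanSpace ℝ (Fin n) → ℝ) (hf : LocallyLipschitz f)
    (xs : EuclideanSpace ℝ (Fin n))
    (G : EuclideanSpace ℝ (Fin n) → Set (EuclideanSpace ℝ (Fin n)))
    -- G is upper semicontinuous with nonempty compact convex values
    (hG_usc : ∀ x : EuclideanSpace ℝ (Fin n), ∀ U : Set (EuclideanSpace ℝ (Fin n)),
      IsOpen U → G x ⊆ U → ∃ δ > (0 : ℝ), ∀ y, ‖y - x‖ ≤ δ → G y ⊆ U)
    (hG_ne : ∀ x, (G x).Nonempty)
    (hG_cpt : ∀ x, IsCompact (G x))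
    (hG_cvx : ∀ x, Convex ℝ (G x))
    -- (i) Łojasiewicz growth: σ : [0, ∞) → [0, ∞) strictly increasing continuous, σ(0) = 0
    (r : ℝ) (hr : 0 < r)
    (σ : ℝ → ℝ)
    (hσ_mono : StrictMonoOn σ (Set.Ici 0))
    (hσ_cont : ContinuousOn σ (Set.Ici 0))
    (hσ_nonneg : ∀ s ∈ Set.Ici (0 : ℝ), 0 ≤ σ s)
    (hσ_zero : σ 0 = 0)
    (hgrowth : ∀ x ∈ closedBall xs r, f x - f xs ≥ σ ‖x - xs‖)
    -- (ii) Kurdyka–Łojasiewicz inequality: ψ : [0, ρ) → [0, ∞) strictly increasing, concave,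
    -- continuous, continuously differentiable on (0, ρ) with derivative ψ', ψ(0) = 0
    (ρ : ℝ) (hρ : 0 < ρ)
    (ψ ψ' : ℝ → ℝ)
    (hψ_mono : StrictMonoOn ψ (Set.Ico 0 ρ))
    (hψ_conc : ConcaveOn ℝ (Set.Ico 0 ρ) ψ)
    (hψ_cont : ContinuousOn ψ (Set.Ico 0 ρ))
    (hψ_nonneg : ∀ s ∈ Set.Ico (0 : ℝ) ρ, 0 ≤ ψ s)
    (hψ_zero : ψ 0 = 0)
    (hψ_deriv : ∀ s ∈ Set.Ioo (0 : ℝ) ρ, HasDerivAt ψ (ψ' s) s)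
    (hψ'_cont : ContinuousOn ψ' (Set.Ioo 0 ρ))
    (hKL : ∀ x ∈ closedBall xs r, 0 < f x - f xs → f x - f xs < ρ →
      infDist 0 (G x) ≥ 1 / ψ' (f x - f xs))
    -- (iii) descent identity along solutions of the differential inclusion x' ∈ -G(x)
    (hdescent : ∀ T > (0 : ℝ), ∀ x v : ℝ → EuclideanSpace ℝ (Fin n),
      IntegrableOn v (Set.Icc 0 T) →
      (∀ t ∈ Set.Icc (0 : ℝ) T, x t = x 0 + ∫ s in (0 : ℝ)..t, v s) →
      (∀ᵐ t ∂(volume.restrict (Set.Ioo (0 : ℝ) T)), v t ∈ -G (x t)) →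
      ∀ t ∈ Set.Icc (0 : ℝ) T,
        f (x t) - f (x 0) = -∫ τ in (0 : ℝ)..t, (infDist 0 (G (x τ))) ^ 2) :
    -- conclusion: x* is a stable point of the dynamics x_{k+1} ∈ x_k - α • G(x_k)
    ∀ ε > (0 : ℝ), ∃ δ > (0 : ℝ), ∃ ᾱ > (0 : ℝ), ∀ α ∈ Set.Ioc (0 : ℝ) ᾱ,
      ∀ x : ℕ → EuclideanSpace ℝ (Fin n), x 0 ∈ closedBall xs δ →
        (∀ k : ℕ, ∃ s ∈ G (x k), x (k + 1) = x k - α • s) →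
        ∀ k : ℕ, x k ∈ closedBall xs ε := by
  intro ε hε
  obtain ⟨L, hL, hLb⟩ := usc_bdd G hG_usc hG_cpt (closedBall xs r) (isCompact_closedBall xs r)
  set e := min ε r with he
  have he0 : 0 < e := lt_min hε hr
  have heε : e ≤ ε := min_le_left _ _
  have her : e ≤ r := min_le_right _ _
  set m := σ (e / 2) with hm
  have hm0 : 0 < m := by
    have := hσ_mono (mem_Ici.2 le_rfl) (mem_Ici.2 (by positivity : (0 : ℝ) ≤ e / 2))
      (by positivity)
    rwa [hσ_zero] at this
  set b := min m ρ / 2 with hb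
  have hmin : 0 < min m ρ := lt_min hm0 hρ
  have hb0 : 0 < b := by positivity
  have hbm : b < m := by linarith [min_le_left m ρ]
  have hbρ : b < ρ := by linarith [min_le_right m ρ]
  set T := e / (4 * L) with hTdef
  have hT : 0 < T := by positivity
  have hLT : e / 2 + L * T ≤ 3 * e / 4 := by
    have : L * T = e / 4 := by rw [hTdef]; field_simp
    linarith
  have hLb' : ∀ x ∈ closedBall xs (3 * e / 4), ∀ s ∈ G x, ‖s‖ ≤ L := fun x hx =>
    hLb x (closedBall_subset_closedBall (by linarith) hx)
  have hψ'pos : 0 < ψ' b := by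
    obtain ⟨y, hy1, hy2⟩ := exists_between hbρ
    have h1 := hψ_conc.slope_le_of_hasDerivAt (x := b) (y := y) ⟨hb0.le, hbρ⟩
      ⟨(hb0.trans hy1).le, hy2⟩ hy1 (hψ_deriv b ⟨hb0, hbρ⟩)
    refine lt_of_lt_of_le ?_ h1
    rw [slope_def_field]
    have := hψ_mono ⟨hb0.le, hbρ⟩ ⟨(hb0.trans hy1).le, hy2⟩ hy1
    exact div_pos (by linarith) (by linarith)
  -- the key step
  have key : ∃ a > (0 : ℝ), ∀ α ∈ Ioc (0 : ℝ) a, ∀ x s : ℕ → EuclideanSpace ℝ (Fin n),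
      x 0 ∈ closedBall xs (e / 2) → f (x 0) - f xs ≤ b → (∀ k, s k ∈ G (x k)) →
      (∀ k, x (k + 1) = x k - α • s k) → f (x ⌊T / α⌋₊) - f xs ≤ b := by
    by_contra hcon
    push Not at hcon
    choose α hα x s hx0 hfx0 hsG hxs hbad using
      fun j : ℕ => hcon (1 / ((j : ℝ) + 1)) (by positivity)
    have hα0 : Tendsto α atTop (𝓝 0) :=
      tendsto_of_tendsto_of_tendsto_of_le_of_le tendsto_const_nhds
        tendsto_one_div_add_atTop_nhds_zero_nat (fun j => (hα j).1.le) (fun j => (hα j).2)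
    have htb := fun j => traj_bound G xs (e / 2) (3 * e / 4) L T (α j) hL.le (hα j).1.le hLb' hLT
      (x j) (s j) (hx0 j) (hsG j) (hxs j)
    obtain ⟨F, X, hFne, hF, ⟨C, hC⟩, hXb, hX0, hXT, hXd⟩ := limit_sol G hG_usc hG_cpt hG_cvx xs
      (3 * e / 4) L T hL hT α (fun j => (hα j).1) hα0 x s hsG hxs (fun j => (htb j).1)
      (fun j => (htb j).2)
    have hfc : Continuous f := hf.continuous
    have hf0 : f (X 0) - f xs ≤ b :=
      le_of_tendsto (((hfc.tendsto _).comp hX0).sub_const (f xs)) (Eventually.of_forall hfx0)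
    have hfT : b ≤ f (X T) - f xs :=
      ge_of_tendsto (((hfc.tendsto _).comp hXT).sub_const (f xs))
        (Eventually.of_forall fun j => (hbad j).le)
    have hdes := hdescent T hT X (deriv X)
      ((intervalIntegrable_iff_integrableOn_Icc_of_le hT.le).1 (ftc_lip X C hC 0 T).1)
      (fun t _ => by rw [(ftc_lip X C hC 0 t).2]; abel)
      (by
        rw [ae_restrict_iff' measurableSet_Ioo]
        filter_upwards [hC.ae_differentiableAt_real] with t ht htT
        exact hXd t htT ht)
    set g : ℝ → ℝ := fun τ => (infDist 0 (G (X τ))) ^ 2 with hg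
    have hgm : Measurable g := by
      have h1 : Measurable (fun y => infDist 0 (G y)) :=
        (lsc_infDist G hG_usc hG_ne).measurable
      exact (h1.comp hC.continuous.measurable).pow_const 2
    have hgb : ∀ τ, ‖g τ‖ ≤ L ^ 2 := by
      intro τ
      obtain ⟨y, hy⟩ := hG_ne (X τ)
      have h1 : infDist 0 (G (X τ)) ≤ L := by
        refine (infDist_le_dist_of_mem hy).trans ?_
        rw [dist_zero_left]
        exact hLb' _ (hXb τ) y hy
      rw [Real.norm_of_nonneg (sq_nonneg _)]
      exact pow_le_pow_left₀ infDist_nonneg h1 2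
    have hgi : ∀ a b : ℝ, IntervalIntegrable g volume a b := fun a b =>
      (intervalIntegrable_const (c := L ^ 2) (μ := volume)).mono_fun'
        hgm.aestronglyMeasurable (Eventually.of_forall hgb)
    have hg0 : ∀ τ, 0 ≤ g τ := fun τ => sq_nonneg _
    have hconst : ∀ t ∈ Icc 0 T, f (X t) - f xs = b := by
      intro t ht
      have h1 := hdes t ht
      have h2 := hdes T ⟨hT.le, le_rfl⟩
      have h3 := intervalIntegral.integral_add_adjacent_intervals (hgi 0 t) (hgi t T)
      have h4 : 0 ≤ ∫ τ in (0 : ℝ)..t, g τ :=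
        intervalIntegral.integral_nonneg ht.1 fun τ _ => hg0 τ
      have h5 : 0 ≤ ∫ τ in t..T, g τ :=
        intervalIntegral.integral_nonneg ht.2 fun τ _ => hg0 τ
      apply le_antisymm <;> linarith
    have hlow : ∀ t ∈ Icc 0 T, (1 / ψ' b) ^ 2 ≤ g t := by
      intro t ht
      have h1 := hconst t ht
      have h2 := hKL (X t) (closedBall_subset_closedBall (by linarith) (hXb t))
        (by rw [h1]; exact hb0) (by rw [h1]; exact hbρ)
      rw [h1] at h2
      exact pow_le_pow_left₀ (by positivity) h2 2
    have hint := intervalIntegral.integral_mono_on hT.le intervalIntegrable_const (hgi 0 T) hlow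
    rw [intervalIntegral.integral_const, smul_eq_mul, sub_zero] at hint
    have h2 := hdes T ⟨hT.le, le_rfl⟩
    have h6 : 0 < T * (1 / ψ' b) ^ 2 := by positivity
    linarith
  obtain ⟨a, ha, hkey⟩ := key
  obtain ⟨δ₀, hδ₀, hδf⟩ : ∃ δ > 0, ∀ y ∈ closedBall xs δ, f y - f xs ≤ b := by
    have : ∀ᶠ y in 𝓝 xs, f y < f xs + b :=
      (hf.continuous.tendsto xs).eventually (gt_mem_nhds (by linarith))
    obtain ⟨δ, hδ, h⟩ := nhds_basis_closedBall.eventually_iff.1 this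
    exact ⟨δ, hδ, fun y hy => by linarith [h hy]⟩
  refine ⟨min δ₀ (e / 2), lt_min hδ₀ (by positivity), min a T, lt_min ha hT, ?_⟩
  intro α hα x hx0 htraj
  choose s hsG hxs using htraj
  have hα0 : 0 < α := hα.1
  have hαT : α ≤ T := hα.2.trans (min_le_right _ _)
  set K := ⌊T / α⌋₊ with hK
  have hK1 : 0 < K := Nat.floor_pos.2 ((one_le_div hα0).2 hαT)
  have hKT : α * K ≤ T := by
    have := Nat.floor_le (div_nonneg hT.le hα0.le)
    rw [le_div_iff₀ hα0] at this
    rw [mul_comm]; exact this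
  have hblock : ∀ p : ℕ, x p ∈ closedBall xs (e / 2) → ∀ k ≤ K,
      x (p + k) ∈ closedBall xs (3 * e / 4) := by
    intro p hp k hk
    refine (traj_bound G xs (e / 2) (3 * e / 4) L T α hL.le hα0.le hLb' hLT
      (fun k => x (p + k)) (fun k => s (p + k)) (by simpa using hp) (fun k => hsG _)
      (fun k => hxs (p + k))).1 k ?_
    exact (mul_le_mul_of_nonneg_left (by exact_mod_cast hk) hα0.le).trans hKT
  have hind : ∀ q : ℕ, x (K * q) ∈ closedBall xs (e / 2) ∧ f (x (K * q)) - f xs ≤ b := by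
    intro q
    induction q with
    | zero =>
      rw [mul_zero]
      exact ⟨closedBall_subset_closedBall (min_le_right _ _) hx0,
        hδf _ (closedBall_subset_closedBall (min_le_left _ _) hx0)⟩
    | succ q ih =>
      have h1 := hblock _ ih.1 K le_rfl
      have h2 : f (x (K * q + K)) - f xs ≤ b :=
        hkey α ⟨hα0, hα.2.trans (min_le_left _ _)⟩ (fun k => x (K * q + k))
          (fun k => s (K * q + k)) (by simpa using ih.1) (by simpa using ih.2) (fun k => hsG _)
          (fun k => hxs (K * q + k))
      rw [mul_add, mul_one]
      refine ⟨?_, h2⟩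
      have h3 := hgrowth _ (closedBall_subset_closedBall (by linarith) h1)
      rw [mem_closedBall, dist_eq_norm]
      by_contra hcon
      push Not at hcon
      have h4 := hσ_mono (mem_Ici.2 (by positivity : (0 : ℝ) ≤ e / 2))
        (mem_Ici.2 (norm_nonneg _)) hcon
      linarith
  intro k
  have h1 := hblock _ (hind (k / K)).1 (k % K) (Nat.mod_lt _ hK1).le
  rw [Nat.div_add_mod] at h1
  exact closedBall_subset_closedBall (by linarith) h1
end

section
/- Let f : ℝⁿ → ℝ be continuous, let x* ∈ ℝⁿ, let r > 0, and let σ : [0, ∞) → [0, ∞) be a strictly increasing continuous function with σ(0) = 0 such that f(x) − f(x*) ≥ σ(‖x − x*‖) for all x ∈ B(x*, r). Then for every ε ∈ (0, r), setting Δ_ε := f(x*) + σ(ε/2), the connected component of the sublevel set {x ∈ ℝⁿ : f(x) ≤ Δ_ε} containing x* is contained in B(x*, ε/2); moreover there exists δ > 0 such that B(x*, δ) is contained in that connected component. -/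
open Metric Set

/-- If `f` is continuous and satisfies the growth condition
`f(x) - f(x*) ≥ σ(‖x - x*‖)` on `B(x*, r)`, then for every `ε ∈ (0, r)`, with
`Δ_ε := f(x*) + σ(ε/2)`, the connected component of the sublevel set
`{x : f(x) ≤ Δ_ε}` containing `x*` is contained in `B(x*, ε/2)`, and it contains a closed
ball `B(x*, δ)` for some `δ > 0`. -/
theorem sublevel_component_inclusions {n : ℕ}
    (f : EuclideanSpace ℝ (Fin n) → ℝ) (hf : Continuous f)
    (xs : EuclideanSpace ℝ (Fin n))
    (r : ℝ) (hr : 0 < r)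
    (σ : ℝ → ℝ)
    (hσ_mono : StrictMonoOn σ (Set.Ici 0))
    (hσ_cont : ContinuousOn σ (Set.Ici 0))
    (hσ_nonneg : ∀ s ∈ Set.Ici (0 : ℝ), 0 ≤ σ s)
    (hσ_zero : σ 0 = 0)
    (hgrowth : ∀ x ∈ closedBall xs r, f x - f xs ≥ σ ‖x - xs‖) :
    ∀ ε ∈ Set.Ioo (0 : ℝ) r,
      connectedComponentIn {x | f x ≤ f xs + σ (ε / 2)} xs ⊆ closedBall xs (ε / 2) ∧
      ∃ δ > (0 : ℝ),
        closedBall xs δ ⊆ connectedComponentIn {x | f x ≤ f xs + σ (ε / 2)} xs := by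
  rintro ε ⟨hε, hεr⟩
  have hpos : 0 < σ (ε / 2) := by
    have := hσ_mono (show (0 : ℝ) ∈ Set.Ici 0 by simp)
      (show ε / 2 ∈ Set.Ici (0 : ℝ) by simp; linarith) (by linarith)
    rwa [hσ_zero] at this
  have hmem : xs ∈ {x | f x ≤ f xs + σ (ε / 2)} := by
    simp only [Set.mem_ofPred_eq]; linarith
  constructor
  · intro y hy
    by_contra hny
    rw [mem_closedBall, not_le] at hny
    have hpre : IsPreconnected ((fun z => dist z xs) ''
        connectedComponentIn {x | f x ≤ f xs + σ (ε / 2)} xs) :=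
      isPreconnected_connectedComponentIn.image _ (by fun_prop)
    have h0 := Set.mem_image_of_mem (fun z => dist z xs) (mem_connectedComponentIn hmem)
    have h1 := Set.mem_image_of_mem (fun z => dist z xs) hy
    have ht : ε / 2 < min (dist y xs) r := lt_min hny (by linarith)
    obtain ⟨z, hz, hzt⟩ := hpre.Icc_subset h0 h1
      (show min (dist y xs) r ∈ _ from
        ⟨by simp only [dist_self]; linarith, min_le_left _ _⟩)
    have hzt : dist z xs = min (dist y xs) r := hzt
    have hg := hgrowth z (by rw [mem_closedBall, hzt]; exact min_le_right _ _)
    rw [← dist_eq_norm, hzt] at hg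
    have hfz := connectedComponentIn_subset _ _ hz
    rw [Set.mem_ofPred_eq] at hfz
    have := hσ_mono (show ε / 2 ∈ Set.Ici (0 : ℝ) by simp; linarith)
      (show min (dist y xs) r ∈ Set.Ici (0 : ℝ) from by
        rw [Set.mem_Ici]; linarith) ht
    linarith
  · have hnhds : {x | f x ≤ f xs + σ (ε / 2)} ∈ nhds xs := by
      have : ∀ᶠ x in nhds xs, f x < f xs + σ (ε / 2) :=
        hf.continuousAt.eventually_lt continuousAt_const (by linarith)
      exact this.mono fun x hx => le_of_lt hx
    obtain ⟨δ, hδ, hsub⟩ := Metric.nhds_basis_closedBall.mem_iff.1 hnhds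
    exact ⟨δ, hδ, (convex_closedBall xs δ).isPreconnected.subset_connectedComponentIn
      (mem_closedBall_self hδ.le) hsub⟩
end

section
/- Let x* ∈ ℝⁿ, L > 0, ε > 0, set T := ε/(3L), and let α ∈ (0, T/2]. Let (x_k)_{k∈ℕ} be a sequence in ℝⁿ such that x₀ ∈ B(x*, ε/2) and such that ‖x_{k+1} − x_k‖ ≤ Lα for every k with x_k ∈ B(x*, ε). Then x_k ∈ B(x*, ε) for all k ∈ {0, 1, …, ⌊T/α⌋ + 1}. -/
open Metric Set

/-- Iterate confinement: let `T := ε / (3L)` and `α ∈ (0, T/2]`. If `x₀ ∈ B(x*, ε/2)` and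
each step taken from a point of `B(x*, ε)` has length at most `L·α`, then the iterates
`x₀, …, x_{⌊T/α⌋+1}` all lie in `B(x*, ε)`. -/
theorem iterates_confined {n : ℕ}
    (xs : EuclideanSpace ℝ (Fin n))
    (L ε : ℝ) (hL : 0 < L) (hε : 0 < ε)
    (α : ℝ) (hα : α ∈ Set.Ioc (0 : ℝ) (ε / (3 * L) / 2))
    (x : ℕ → EuclideanSpace ℝ (Fin n))
    (h0 : x 0 ∈ closedBall xs (ε / 2))
    (hstep : ∀ k : ℕ, x k ∈ closedBall xs ε → ‖x (k + 1) - x k‖ ≤ L * α) :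
    ∀ k ≤ ⌊ε / (3 * L) / α⌋₊ + 1, x k ∈ closedBall xs ε := by
  obtain ⟨hα0, hα1⟩ := hα
  have hT : L * (ε / (3 * L)) = ε / 3 := by field_simp
  have hLα : L * α ≤ ε / 6 := by
    have := mul_le_mul_of_nonneg_left hα1 hL.le
    linarith
  have hLα0 : 0 < L * α := mul_pos hL hα0
  have bound : ∀ k : ℕ, k ≤ ⌊ε / (3 * L) / α⌋₊ + 1 → (k : ℝ) * (L * α) ≤ ε / 2 := by
    intro k hk
    have h1 : (k : ℝ) ≤ (⌊ε / (3 * L) / α⌋₊ : ℝ) + 1 := by exact_mod_cast hk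
    have h2 : (⌊ε / (3 * L) / α⌋₊ : ℝ) ≤ ε / (3 * L) / α := Nat.floor_le (by positivity)
    have h3 : ε / (3 * L) / α * (L * α) = ε / 3 := by field_simp
    have h4 := mul_le_mul_of_nonneg_right (h1.trans (add_le_add_left h2 1)) hLα0.le
    linarith
  have key : ∀ k : ℕ, k ≤ ⌊ε / (3 * L) / α⌋₊ + 1 →
      dist (x k) xs ≤ ε / 2 + (k : ℝ) * (L * α) := by
    intro k
    induction k with
    | zero => intro _; simpa using h0
    | succ k ih =>
      intro hk
      have hk' : k ≤ ⌊ε / (3 * L) / α⌋₊ + 1 := by omega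
      have h1 := ih hk'
      have h2 := bound k hk'
      have h3 := hstep k (mem_closedBall.2 (by linarith))
      rw [← dist_eq_norm] at h3
      have h4 := dist_triangle (x (k + 1)) (x k) xs
      push_cast
      linarith
  intro k hk
  have h1 := key k hk
  have h2 := bound k hk
  exact mem_closedBall.2 (by linarith)
end

section
/- Let α > 0, let x₁ ∈ ℝ with x₁ ≥ 1/2, and let x₂ ∈ ℝ with 0 < |x₂| ≤ α²/32. Then |x₂ − (3α/2)|x₁|^{3/2}|x₂|^{1/2} sign(x₂)| ≥ 2|x₂|, where sign(x) := −1 if x < 0 and sign(x) := 1 if x > 0. -/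
/-- `sign(x) = -1` if `x < 0` and `sign(x) = 1` if `x > 0` (valued `1` at `0`, where it is
never used). -/
noncomputable def sgn (x : ℝ) : ℝ := if x < 0 then -1 else 1

/-- Doubling estimate: if `α > 0`, `x₁ ≥ 1/2` and `0 < |x₂| ≤ α²/32`, then
`|x₂ - (3α/2)|x₁|^{3/2}|x₂|^{1/2} sign(x₂)| ≥ 2|x₂|`. -/
theorem doubling_estimate (α x₁ x₂ : ℝ) (hα : 0 < α) (h₁ : 1 / 2 ≤ x₁)
    (h₂ : 0 < |x₂|) (h₂' : |x₂| ≤ α ^ 2 / 32) :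
    |x₂ - 3 * α / 2 * |x₁| ^ (3 / 2 : ℝ) * |x₂| ^ (1 / 2 : ℝ) * sgn x₂| ≥ 2 * |x₂| := by
  have hx : 0 < x₁ := by linarith
  rw [abs_of_pos hx]
  have hP : 0 < x₁ ^ (3 / 2 : ℝ) := Real.rpow_pos_of_pos hx _
  have hP2 : (x₁ ^ (3 / 2 : ℝ)) ^ 2 = x₁ ^ 3 := by
    rw [← Real.rpow_natCast, ← Real.rpow_mul hx.le, ← Real.rpow_natCast]
    norm_num
  have hs : 0 < |x₂| ^ (1 / 2 : ℝ) := Real.rpow_pos_of_pos h₂ _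
  have hs2 : (|x₂| ^ (1 / 2 : ℝ)) ^ 2 = |x₂| := by
    rw [← Real.rpow_natCast, ← Real.rpow_mul h₂.le]
    norm_num
  have h8 : (1 / 2 : ℝ) ^ 3 ≤ x₁ ^ 3 := pow_le_pow_left₀ (by norm_num) h₁ 3
  generalize x₁ ^ (3 / 2 : ℝ) = P at *
  generalize |x₂| ^ (1 / 2 : ℝ) = s at *
  have key : 2 * s ≤ α * P := by
    refine (sq_le_sq₀ (by positivity) (by positivity)).mp ?_
    rw [mul_pow, mul_pow, hs2, hP2]
    nlinarith [mul_le_mul_of_nonneg_left h8 (sq_nonneg α)]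
  have key2 : 3 * |x₂| ≤ 3 * α / 2 * P * s := by
    nlinarith [mul_le_mul_of_nonneg_right key hs.le]
  unfold sgn
  split_ifs with h
  · rw [abs_of_neg h] at *
    exact le_trans (by linarith) (le_abs_self _)
  · rw [abs_of_nonneg (not_lt.mp h)] at *
    exact le_trans (by linarith) (neg_le_abs _)
end
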